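/- Asymptotic formula for doubled shifted plane partitions: for every integer m ≥ 2, the number DSPP_m(n) of doubled shifted plane partitions of width m and size n satisfies, as n → ∞, DSPP_m(n) ~ C(m) · (1/n) · exp(π √((m²+m+2)n/(6m))), where C(m) = (∏_{i=1}^{m−2} ∏_{j=i+1}^{m−i−1} sin((i+j)π/(2m)))^{−1} · √(m²+m+2) / (2^{(m²−3m+14)/4} √(3m)). -/

import Mathlib

open scoped BigOperators

/-- An integer partition: a weakly decreasing, finitely supported sequence of
nonnegative integers. -/
structure Ptn where
  toFun : ℕ →₀ ℕ
  antitone' : ∀ ⦃i j : ℕ⦄, i ≤ j → toFun j ≤ toFun i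

namespace Ptn
/-- the `i`-th part (0-indexed) -/
def part (lam : Ptn) (i : ℕ) : ℕ := lam.toFun i
/-- the size `|λ|` -/
def size (lam : Ptn) : ℕ := lam.toFun.sum fun _ k => k
end Ptn

/-- `HStrip μ λ` means `μ ≺ λ`, i.e. `λ/μ` is a horizontal strip:
`λ_i ≥ μ_i ≥ λ_{i+1}` for all `i`. -/
def HStrip (mu lam : Ptn) : Prop :=
  ∀ i : ℕ, mu.part i ≤ lam.part i ∧ lam.part (i + 1) ≤ mu.part i
/-- `δ` is a `±1`-profile on the indices `1, …, h` -/
def IsProfile (h : ℕ) (δ : ℕ → ℤ) : Prop := ∀ i, 1 ≤ i → i ≤ h → δ i = 1 ∨ δ i = -1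

/-- A skew doubled shifted plane partition `ω = (λ^0, …, λ^{m-1})` with profile
`(δ_1, …, δ_{m-1})`: if `δ_{i+1} = 1` then `λ^i ≺ λ^{i+1}`, and if
`δ_{i+1} = -1` then `λ^i ≻ λ^{i+1}`. -/
def IsDSPP (m : ℕ) (δ : ℕ → ℤ) (L : Fin m → Ptn) : Prop :=
  ∀ (i : ℕ) (hi : i + 1 < m),
    if δ (i + 1) = 1 then HStrip (L ⟨i, Nat.lt_of_succ_lt hi⟩) (L ⟨i + 1, hi⟩)
    else HStrip (L ⟨i + 1, hi⟩) (L ⟨i, Nat.lt_of_succ_lt hi⟩)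

/-- `DSPPcount m n` is the number of doubled shifted plane partitions of
width `m` (profile `δ = (-1)^{m-1}`) and size `n` -/
noncomputable def DSPPcount (m n : ℕ) : ℕ :=
  Nat.card {L : Fin m → Ptn // IsDSPP m (fun _ => -1) L ∧ ∑ i, (L i).size = n}

/-- the constant `C(m)` of Theorem 1.2 -/
noncomputable def Cconst (m : ℕ) : ℝ :=
  (∏ i ∈ Finset.Icc 1 (m - 2), ∏ j ∈ Finset.Icc (i + 1) (m - i - 1),
      Real.sin (((i : ℝ) + (j : ℝ)) * Real.pi / (2 * m)))⁻¹ *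
    Real.sqrt ((m : ℝ) ^ 2 + m + 2) /
      ((2 : ℝ) ^ ((((m : ℝ) ^ 2 - 3 * m + 14)) / 4) * Real.sqrt (3 * m))

open Filter Topology

/-- The function `x ↦ -log (1 - e^{-x})`: minus the logarithm of an Euler factor. -/
noncomputable def eulerLog (x : ℝ) : ℝ := -Real.log (1 - Real.exp (-x))

theorem eulerLog_nonneg {x : ℝ} (hx : 0 < x) : 0 ≤ eulerLog x := by
  have h1 : Real.exp (-x) < 1 := Real.exp_lt_one_iff.2 (by linarith)
  have := Real.log_nonpos (by linarith) (by linarith [Real.exp_pos (-x)] : 1 - Real.exp (-x) ≤ 1)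
  unfold eulerLog
  linarith

theorem eulerLog_le {x : ℝ} (hx : 0 < x) :
    eulerLog x ≤ Real.exp (-x) / (1 - Real.exp (-x)) := by
  have h1 : Real.exp (-x) < 1 := Real.exp_lt_one_iff.2 (by linarith)
  have h2 : 0 < 1 - Real.exp (-x) := by linarith
  have := Real.one_sub_inv_le_log_of_pos h2
  unfold eulerLog
  have h3 : Real.exp (-x) / (1 - Real.exp (-x)) = (1 - Real.exp (-x))⁻¹ - 1 := by
    field_simp
    ring
  linarith

theorem eulerLog_le_of_le {x y : ℝ} (hx : 0 < x) (hxy : x ≤ y) :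
    eulerLog y ≤ Real.exp (-y) / (1 - Real.exp (-x)) := by
  refine (eulerLog_le (hx.trans_le hxy)).trans ?_
  have h1 : Real.exp (-x) < 1 := Real.exp_lt_one_iff.2 (by linarith)
  have h2 : Real.exp (-y) ≤ Real.exp (-x) := Real.exp_le_exp.2 (by linarith)
  gcongr

theorem summable_eulerLog {b s : ℝ} (hb : 0 < b) (hs : 0 < s) :
    Summable fun n : ℕ => eulerLog ((n + b) * s) := by
  have hbs : 0 < b * s := mul_pos hb hs
  have hle : ∀ n : ℕ, b * s ≤ (n + b) * s := fun n => by
    have : 0 ≤ (n : ℝ) * s := by positivity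
    linarith
  refine Summable.of_nonneg_of_le (fun n => eulerLog_nonneg (hbs.trans_le (hle n)))
    (fun n => eulerLog_le_of_le hbs (hle n)) ?_
  refine Summable.div_const ?_ _
  have : ∀ n : ℕ, Real.exp (-((n + b) * s)) = Real.exp (-(b * s)) * Real.exp (-s) ^ n := by
    intro n
    rw [← Real.exp_nat_mul, ← Real.exp_add]
    ring_nf
  simp only [this]
  exact (summable_geometric_of_lt_one (Real.exp_pos _).le
    (Real.exp_lt_one_iff.2 (by linarith))).mul_left _

/-- `logPartitionGF s` is the logarithm of `∏_{n ≥ 1} (1 - e^{-ns})⁻¹`. -/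
noncomputable def logPartitionGF (s : ℝ) : ℝ := ∑' n : ℕ, eulerLog ((n + 1) * s)

theorem norm_eta_I_mul {y : ℝ} (hy : 0 < y) :
    ‖ModularForm.eta (Complex.I * y)‖ =
      Real.exp (-(2 * Real.pi * y / 24) - logPartitionGF (2 * Real.pi * y)) := by
  have hs : 0 < 2 * Real.pi * y := by positivity
  have hq : Function.Periodic.qParam 1 (Complex.I * y) = (Real.exp (-(2 * Real.pi * y)) : ℝ) := by
    simp only [Function.Periodic.qParam, Complex.ofReal_exp]
    congr 1
    push_cast
    linear_combination (2 * Real.pi * y : ℂ) * Complex.I_sq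
  have hq1 : Real.exp (-(2 * Real.pi * y)) < 1 := Real.exp_lt_one_iff.2 (by linarith)
  unfold ModularForm.eta
  rw [norm_mul, sub_eq_add_neg, Real.exp_add]
  congr 1
  · simp only [Function.Periodic.qParam, Complex.norm_exp]
    congr 1
    have : (2 * Real.pi * Complex.I * (Complex.I * y) / (24 : ℝ) : ℂ)
        = ((-(2 * Real.pi * y / 24) : ℝ) : ℂ) := by
      push_cast
      linear_combination (2 * Real.pi * y / 24 : ℂ) * Complex.I_sq
    rw [this, Complex.ofReal_re]
  · have hm : Multipliable fun n : ℕ => 1 - ModularForm.eta_q n (Complex.I * y) := by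
      apply ModularForm.multipliable_one_sub_pow
      rw [hq, Complex.norm_real, Real.norm_of_nonneg (Real.exp_pos _).le]
      exact hq1
    rw [hm.norm_tprod]
    have hterm : ∀ n : ℕ, ‖1 - ModularForm.eta_q n (Complex.I * y)‖
        = 1 - Real.exp (-((n + 1) * (2 * Real.pi * y))) := by
      intro n
      have : (1 - ModularForm.eta_q n (Complex.I * y) : ℂ)
          = ((1 - Real.exp (-((n + 1) * (2 * Real.pi * y))) : ℝ) : ℂ) := by
        rw [ModularForm.eta_q, hq, ← Complex.ofReal_pow, ← Real.exp_nat_mul]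
        push_cast
        ring_nf
      rw [this, Complex.norm_real, Real.norm_of_nonneg]
      have : Real.exp (-((n + 1) * (2 * Real.pi * y))) ≤ 1 :=
        Real.exp_le_one_iff.2 (neg_nonpos.2 (by positivity))
      linarith
    simp only [hterm]
    rw [← Real.rexp_tsum_eq_tprod]
    · rw [logPartitionGF, ← tsum_neg]
      simp [eulerLog]
    · intro n
      have : Real.exp (-((n + 1) * (2 * Real.pi * y))) < 1 :=
        Real.exp_lt_one_iff.2 (neg_lt_zero.2 (by positivity))
      linarith
    · have := (summable_eulerLog one_pos hs).neg
      simpa [eulerLog] using this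

/-- The modular transformation of the partition generating function on the positive axis. -/
theorem logPartitionGF_transform {s : ℝ} (hs : 0 < s) :
    logPartitionGF s = Real.pi ^ 2 / (6 * s) + Real.log s / 2 - Real.log (2 * Real.pi) / 2
      - s / 24 + logPartitionGF (4 * Real.pi ^ 2 / s) := by
  have hπ := Real.pi_pos
  set y := s / (2 * Real.pi) with hy
  have hy0 : 0 < y := by positivity
  have key := ModularForm.eta_comp_eq_csqrt_I_inv (x := Complex.I * y)
    (by simp [UpperHalfPlane.upperHalfPlaneSet, hy0])
  have hinv : (-1 / (Complex.I * y) : ℂ) = Complex.I * ((1 / y : ℝ) : ℂ) := by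
    have : (y : ℂ) ≠ 0 := by exact_mod_cast hy0.ne'
    push_cast
    field_simp
    simp
  simp only [Function.comp_apply, Pi.smul_apply, Pi.mul_apply, hinv] at key
  have hn := congrArg norm key
  have hsq : ∀ z : ℂ, z ≠ 0 → ‖Complex.sqrt z‖ = ‖z‖ ^ (2⁻¹ : ℝ) := by
    intro z hz
    rw [Complex.sqrt, show (2⁻¹ : ℂ) = ((2⁻¹ : ℝ) : ℂ) by push_cast; rfl,
      Complex.norm_cpow_real]
  rw [norm_smul, norm_mul, norm_inv, hsq _ Complex.I_ne_zero, hsq _ (by simp [hy0.ne']),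
    norm_eta_I_mul hy0, norm_eta_I_mul (by positivity)] at hn
  simp only [Complex.norm_I, Real.one_rpow, norm_mul, Complex.norm_real, one_mul, inv_one,
    Real.norm_of_nonneg hy0.le] at hn
  have hl := congrArg Real.log hn
  rw [Real.log_exp, Real.log_mul (by positivity) (Real.exp_pos _).ne', Real.log_exp,
    Real.log_rpow hy0, show 2 * Real.pi * y = s by rw [hy]; field_simp,
    show 2 * Real.pi * (1 / y) = 4 * Real.pi ^ 2 / s by rw [hy]; field_simp; ring,
    hy, Real.log_div hs.ne' (by positivity)] at hl
  have : 4 * Real.pi ^ 2 / s / 24 = Real.pi ^ 2 / (6 * s) := by field_simp; ring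
  linarith

theorem tendsto_logPartitionGF_atTop : Tendsto logPartitionGF atTop (𝓝 0) := by
  have h : ∀ s : ℝ, 1 ≤ s → 0 ≤ logPartitionGF s ∧
      logPartitionGF s ≤ Real.exp (-s) * (∑' n : ℕ, Real.exp (-1) ^ n / (1 - Real.exp (-1))) := by
    intro s hs
    have hs0 : 0 < s := by linarith
    have hle : ∀ n : ℕ, 1 ≤ ((n : ℝ) + 1) * s := fun n => by
      have : 0 ≤ (n : ℝ) * s := by positivity
      linarith
    have he1 : Real.exp (-1) < 1 := Real.exp_lt_one_iff.2 (by norm_num)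
    refine ⟨tsum_nonneg fun n => eulerLog_nonneg (by linarith [hle n]), ?_⟩
    rw [logPartitionGF, ← tsum_mul_left]
    refine (summable_eulerLog one_pos hs0).tsum_le_tsum (fun n => ?_)
      (((summable_geometric_of_lt_one (Real.exp_pos _).le he1).div_const _).mul_left _)
    refine (eulerLog_le_of_le one_pos (hle n)).trans ?_
    rw [← mul_div_assoc, ← Real.exp_nat_mul, ← Real.exp_add]
    have : 0 ≤ 1 - Real.exp (-1) := by linarith
    gcongr
    nlinarith [Nat.cast_nonneg (α := ℝ) n]
  refine tendsto_of_tendsto_of_tendsto_of_le_of_le' tendsto_const_nhds (h := fun s =>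
    Real.exp (-s) * (∑' n : ℕ, Real.exp (-1) ^ n / (1 - Real.exp (-1)))) ?_ ?_ ?_
  · simpa using Real.tendsto_exp_neg_atTop_nhds_zero.mul_const
      (∑' n : ℕ, Real.exp (-1) ^ n / (1 - Real.exp (-1)))
  · filter_upwards [eventually_ge_atTop 1] with s hs using (h s hs).1
  · filter_upwards [eventually_ge_atTop 1] with s hs using (h s hs).2

/-- The behaviour of `∏_{n ≥ 1} (1 - e^{-ns})⁻¹` as `s → 0⁺`. -/
theorem tendsto_logPartitionGF :
    Tendsto (fun s => logPartitionGF s - Real.pi ^ 2 / (6 * s) - Real.log s / 2) (𝓝[>] 0)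
      (𝓝 (-(Real.log (2 * Real.pi) / 2))) := by
  have h1 : Tendsto (fun s : ℝ => logPartitionGF (4 * Real.pi ^ 2 / s)) (𝓝[>] 0) (𝓝 0) := by
    refine tendsto_logPartitionGF_atTop.comp ?_
    exact (tendsto_inv_nhdsGT_zero.const_mul_atTop
      (by positivity : 0 < 4 * Real.pi ^ 2)).congr fun s => (div_eq_mul_inv _ _).symm
  have h2 : Tendsto (fun s : ℝ => s / 24) (𝓝[>] 0) (𝓝 0) := by
    have : Tendsto (fun s : ℝ => s / 24) (𝓝 0) (𝓝 (0 / 24)) := tendsto_id.div_const _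
    rw [zero_div] at this
    exact this.mono_left nhdsWithin_le_nhds
  have h3 := (h1.sub h2).sub_const (Real.log (2 * Real.pi) / 2)
  rw [sub_self, zero_sub] at h3
  refine h3.congr' ?_
  filter_upwards [self_mem_nhdsWithin] with s hs
  rw [logPartitionGF_transform (s := s) hs]
  ring

/-- `logProgressionGF b s` is the logarithm of `∏_{k ≥ 0} (1 - e^{-(k+b)s})⁻¹`. -/
noncomputable def logProgressionGF (b s : ℝ) : ℝ := ∑' k : ℕ, eulerLog ((k + b) * s)

theorem logProgressionGF_half {s : ℝ} (hs : 0 < s) :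
    logProgressionGF (1 / 2) s = logPartitionGF (s / 2) - logPartitionGF s := by
  have hodd : ∀ k : ℕ, eulerLog ((((2 * k : ℕ) : ℝ) + 1) * (s / 2))
      = eulerLog (((k : ℝ) + 1 / 2) * s) := fun k => by
    congr 1
    push_cast
    ring
  have heven : ∀ k : ℕ, eulerLog ((((2 * k + 1 : ℕ) : ℝ) + 1) * (s / 2))
      = eulerLog (((k : ℝ) + 1) * s) := fun k => by
    congr 1
    push_cast
    ring
  have h := tsum_even_add_odd (f := fun n : ℕ => eulerLog ((n + 1) * (s / 2)))
    (by simpa only [hodd] using summable_eulerLog (b := 1 / 2) (by norm_num) hs)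
    (by simpa only [heven] using summable_eulerLog one_pos hs)
  simp only [hodd, heven] at h
  rw [logProgressionGF, logPartitionGF, logPartitionGF, ← h]
  ring

theorem tendsto_logProgressionGF_half :
    Tendsto (fun s => logProgressionGF (1 / 2) s - Real.pi ^ 2 / (6 * s)) (𝓝[>] 0)
      (𝓝 (-(Real.log 2 / 2))) := by
  have hhalf : Tendsto (fun s : ℝ => s / 2) (𝓝[>] 0) (𝓝[>] 0) := by
    refine tendsto_nhdsWithin_iff.2 ⟨?_, ?_⟩
    · have : Tendsto (fun s : ℝ => s / 2) (𝓝 0) (𝓝 (0 / 2)) := tendsto_id.div_const _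
      rw [zero_div] at this
      exact this.mono_left nhdsWithin_le_nhds
    · filter_upwards [self_mem_nhdsWithin] with s hs
      exact half_pos (show 0 < s from hs)
  have h := ((tendsto_logPartitionGF.comp hhalf).sub tendsto_logPartitionGF).sub_const
    (Real.log 2 / 2)
  rw [sub_self, zero_sub] at h
  refine h.congr' ?_
  filter_upwards [self_mem_nhdsWithin] with s hs
  have hs : 0 < s := hs
  rw [logProgressionGF_half hs, Function.comp_apply, Real.log_div hs.ne' two_ne_zero]
  field_simp
  ring

theorem tendsto_eulerLog_mul_add_log {c : ℝ} (hc : 0 < c) :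
    Tendsto (fun s => eulerLog (c * s) + Real.log s) (𝓝[>] 0) (𝓝 (-Real.log c)) := by
  have hd : HasDerivAt (fun s : ℝ => 1 - Real.exp (-(c * s))) c 0 := by
    have := (((hasDerivAt_id (0 : ℝ)).const_mul c).neg.exp).const_sub 1
    simpa using this
  have hslope := hd.tendsto_slope_zero_right
  have hlog := ((Real.continuousAt_log hc.ne').tendsto.comp hslope).neg
  refine hlog.congr' ?_
  filter_upwards [self_mem_nhdsWithin] with s hs
  have hs : 0 < s := hs
  have h1 : Real.exp (-(c * s)) < 1 := Real.exp_lt_one_iff.2 (neg_lt_zero.2 (mul_pos hc hs))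
  simp only [Function.comp_apply, zero_add, mul_zero, neg_zero, Real.exp_zero, sub_self, sub_zero,
    smul_eq_mul, eulerLog]
  rw [Real.log_mul (inv_ne_zero hs.ne') (by linarith), Real.log_inv]
  ring

theorem eulerLog_second_difference {x d : ℝ} (hx : |d| < x) :
    eulerLog (x - d) + eulerLog (x + d) - 2 * eulerLog x
      = Real.log (1 + Real.sinh (d / 2) ^ 2 / (Real.sinh ((x + d) / 2) * Real.sinh ((x - d) / 2))) := by
  obtain ⟨h1, h2⟩ := abs_lt.1 hx
  have hx0 : 0 < x := (abs_nonneg d).trans_lt hx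
  have hs : ∀ y : ℝ, 1 - Real.exp (-y) = 2 * Real.exp (-(y / 2)) * Real.sinh (y / 2) := by
    intro y
    rw [Real.sinh_eq]
    have e1 : Real.exp (-y) = Real.exp (-(y / 2)) * Real.exp (-(y / 2)) := by
      rw [← Real.exp_add]; ring_nf
    have e2 : Real.exp (-(y / 2)) * Real.exp (y / 2) = 1 := by
      rw [← Real.exp_add]; simp
    rw [e1]
    linear_combination -e2
  have hf : ∀ y : ℝ, 0 < y → eulerLog y = -(Real.log 2 - y / 2 + Real.log (Real.sinh (y / 2))) := by
    intro y hy
    have : 0 < Real.sinh (y / 2) := Real.sinh_pos_iff.2 (by linarith)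
    rw [eulerLog, hs, Real.log_mul (by positivity) this.ne',
      Real.log_mul (by norm_num) (Real.exp_pos _).ne', Real.log_exp]
    ring
  have p1 : 0 < Real.sinh ((x + d) / 2) := Real.sinh_pos_iff.2 (by linarith)
  have p2 : 0 < Real.sinh ((x - d) / 2) := Real.sinh_pos_iff.2 (by linarith)
  have p3 : 0 < Real.sinh (x / 2) := Real.sinh_pos_iff.2 (by linarith)
  have key : Real.sinh ((x + d) / 2) * Real.sinh ((x - d) / 2) + Real.sinh (d / 2) ^ 2
      = Real.sinh (x / 2) ^ 2 := by
    rw [add_div, sub_div, Real.sinh_add, Real.sinh_sub]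
    have c1 := Real.cosh_sq (x / 2)
    have c2 := Real.cosh_sq (d / 2)
    linear_combination -(Real.sinh (d / 2)) ^ 2 * c1 + Real.sinh (x / 2) ^ 2 * c2
  have : 1 + Real.sinh (d / 2) ^ 2 / (Real.sinh ((x + d) / 2) * Real.sinh ((x - d) / 2))
      = Real.sinh (x / 2) ^ 2 / (Real.sinh ((x + d) / 2) * Real.sinh ((x - d) / 2)) := by
    rw [← key]
    field_simp
  rw [this, Real.log_div (by positivity) (by positivity), Real.log_mul p1.ne' p2.ne',
    Real.log_pow, hf _ (by linarith), hf _ (by linarith), hf _ hx0]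
  push_cast
  ring

theorem abs_eulerLog_second_difference_le {x d : ℝ} (hx : |d| < x) (hd : |d| ≤ 1) :
    |eulerLog (x - d) + eulerLog (x + d) - 2 * eulerLog x| ≤ 4 * d ^ 2 / ((x + d) * (x - d)) := by
  obtain ⟨h1, h2⟩ := abs_lt.1 hx
  rw [eulerLog_second_difference hx]
  have q1 : (x + d) / 2 ≤ Real.sinh ((x + d) / 2) := Real.self_le_sinh_iff.2 (by linarith)
  have q2 : (x - d) / 2 ≤ Real.sinh ((x - d) / 2) := Real.self_le_sinh_iff.2 (by linarith)
  have p1 : 0 < (x + d) / 2 := by linarith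
  have p2 : 0 < (x - d) / 2 := by linarith
  have hsinh : Real.sinh (d / 2) ^ 2 ≤ d ^ 2 := by
    rw [← sq_abs, ← sq_abs d, Real.abs_sinh]
    have hy := Real.abs_exp_sub_one_le (x := |d / 2|) (by
      rw [abs_abs, abs_div]; norm_num; linarith)
    have hy' := Real.abs_exp_sub_one_le (x := -|d / 2|) (by
      rw [abs_neg, abs_abs, abs_div]; norm_num; linarith)
    rw [abs_neg, abs_abs] at hy'
    rw [abs_abs] at hy
    have hab : |d / 2| = |d| / 2 := by rw [abs_div]; norm_num
    have b1 := (abs_le.1 hy).2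
    have b2 := (abs_le.1 hy').1
    rw [hab] at b1 b2 ⊢
    have : Real.sinh (|d| / 2) ≤ |d| := by
      rw [Real.sinh_eq]
      linarith
    have h0 : 0 ≤ Real.sinh (|d| / 2) := Real.sinh_nonneg_iff.2 (by positivity)
    gcongr
  set t := Real.sinh (d / 2) ^ 2 / (Real.sinh ((x + d) / 2) * Real.sinh ((x - d) / 2)) with ht
  have ht0 : 0 ≤ t := div_nonneg (sq_nonneg _)
    (mul_nonneg (p1.le.trans q1) (p2.le.trans q2))
  have hl0 : 0 ≤ Real.log (1 + t) := Real.log_nonneg (by linarith)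
  rw [abs_of_nonneg hl0]
  have hl1 := Real.log_le_sub_one_of_pos (by linarith : 0 < 1 + t)
  have : t ≤ d ^ 2 / ((x + d) / 2 * ((x - d) / 2)) := by
    rw [ht]
    gcongr
  calc Real.log (1 + t) ≤ t := by linarith
    _ ≤ _ := this
    _ = _ := by field_simp; ring

theorem tendsto_prod_one_sub_sq_div_half {x : ℝ} (hx : |x| < 1 / 2) :
    Tendsto (fun N : ℕ => ∏ n ∈ Finset.range N, (1 - x ^ 2 / ((n : ℝ) + 1 / 2) ^ 2)) atTop
      (𝓝 (Real.cos (Real.pi * x))) := by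
  by_cases hx0 : x = 0
  · simp [hx0]
  have hπ := Real.pi_pos
  obtain ⟨hx1, hx2⟩ := abs_lt.1 hx
  have hsin : Real.sin (Real.pi * x) ≠ 0 := by
    intro h
    rw [Real.sin_eq_zero_iff_of_lt_of_lt (by nlinarith) (by nlinarith)] at h
    exact hx0 ((mul_eq_zero.1 h).resolve_left hπ.ne')
  have h1 := Real.tendsto_euler_sin_prod x
  have h2 := (Real.tendsto_euler_sin_prod (2 * x)).comp (tendsto_id.const_mul_atTop' two_pos)
  have h3 := (h2.div h1 hsin).div_const 2
  have hlim : Real.sin (Real.pi * (2 * x)) / Real.sin (Real.pi * x) / 2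
      = Real.cos (Real.pi * x) := by
    rw [show Real.pi * (2 * x) = 2 * (Real.pi * x) by ring, Real.sin_two_mul]
    field_simp
  rw [hlim] at h3
  refine h3.congr fun N => ?_
  have hprod : ∀ N : ℕ, ∏ j ∈ Finset.range (2 * N), (1 - (2 * x) ^ 2 / ((j : ℝ) + 1) ^ 2)
      = (∏ n ∈ Finset.range N, (1 - x ^ 2 / ((n : ℝ) + 1 / 2) ^ 2)) *
        ∏ j ∈ Finset.range N, (1 - x ^ 2 / ((j : ℝ) + 1) ^ 2) := by
    intro N
    induction N with
    | zero => simp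
    | succ N ih =>
      rw [show 2 * (N + 1) = 2 * N + 1 + 1 by ring, Finset.prod_range_succ, Finset.prod_range_succ,
        ih, Finset.prod_range_succ, Finset.prod_range_succ]
      have e1 : (2 * x) ^ 2 / (((2 * N : ℕ) : ℝ) + 1) ^ 2 = x ^ 2 / ((N : ℝ) + 1 / 2) ^ 2 := by
        push_cast
        rw [div_eq_div_iff (by positivity) (by positivity)]
        ring
      have e2 : (2 * x) ^ 2 / (((2 * N + 1 : ℕ) : ℝ) + 1) ^ 2 = x ^ 2 / ((N : ℝ) + 1) ^ 2 := by
        push_cast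
        rw [div_eq_div_iff (by positivity) (by positivity)]
        ring
      rw [e1, e2]
      ring
  have hne : ∏ j ∈ Finset.range N, (1 - x ^ 2 / ((j : ℝ) + 1) ^ 2) ≠ 0 := by
    refine Finset.prod_ne_zero_iff.2 fun j _ => ?_
    have : x ^ 2 / ((j : ℝ) + 1) ^ 2 < 1 := by
      rw [div_lt_one (by positivity)]
      nlinarith [Nat.cast_nonneg (α := ℝ) j]
    linarith
  simp only [Pi.div_apply, Function.comp_apply, id_eq, hprod]
  generalize ∏ j ∈ Finset.range N, (1 - x ^ 2 / ((j : ℝ) + 1) ^ 2) = P at hne ⊢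
  generalize ∏ n ∈ Finset.range N, (1 - x ^ 2 / ((n : ℝ) + 1 / 2) ^ 2) = Q
  field_simp

/-- Comparison of a pair of complementary progressions with the central one. -/
theorem tendsto_logProgressionGF_add {b : ℝ} (hb0 : 0 < b) (hb1 : b < 1) :
    Tendsto (fun s => logProgressionGF b s + logProgressionGF (1 - b) s
      - 2 * logProgressionGF (1 / 2) s) (𝓝[>] 0) (𝓝 (-Real.log (Real.sin (Real.pi * b)))) := by
  have hx : |1 / 2 - b| < 1 / 2 := abs_lt.2 ⟨by linarith, by linarith⟩
  set g : ℕ → ℝ := fun n => -Real.log (1 - (1 / 2 - b) ^ 2 / ((n : ℝ) + 1 / 2) ^ 2) with hg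
  have hpos : ∀ n : ℕ, 0 < 1 - (1 / 2 - b) ^ 2 / ((n : ℝ) + 1 / 2) ^ 2 := by
    intro n
    have : (1 / 2 - b) ^ 2 / ((n : ℝ) + 1 / 2) ^ 2 < 1 := by
      rw [div_lt_one (by positivity)]
      nlinarith [Nat.cast_nonneg (α := ℝ) n]
    linarith
  have hden : ∀ n : ℕ, 0 < (n + b) * (n + (1 - b)) := fun n => by
    have : 0 < 1 - b := by linarith
    positivity
  have hbound : Summable fun n : ℕ => 1 / ((n + b) * ((n : ℝ) + (1 - b))) := by
    rw [← summable_nat_add_iff 1]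
    have hz := (summable_nat_add_iff 1).2 (Real.summable_one_div_nat_pow.2 one_lt_two)
    refine Summable.of_nonneg_of_le (fun n => one_div_nonneg.2 (hden _).le) (fun n => ?_) hz
    push_cast
    gcongr
    nlinarith [Nat.cast_nonneg (α := ℝ) n, mul_nonneg (Nat.cast_nonneg (α := ℝ) n) hb0.le]
  have hlim := tendsto_tsum_of_dominated_convergence (𝓕 := 𝓝[>] (0 : ℝ))
    (f := fun s (n : ℕ) => eulerLog ((n + b) * s) + eulerLog ((n + (1 - b)) * s)
      - 2 * eulerLog ((n + 1 / 2) * s)) (g := g) hbound ?_ ?_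
  · have hval : ∑' n, g n = -Real.log (Real.sin (Real.pi * b)) := by
      have hsum : Summable g := by
        refine hbound.of_nonneg_of_le (fun n => ?_) (fun n => ?_)
        · exact neg_nonneg.2 (Real.log_nonpos (hpos n).le (by
            have : 0 ≤ (1 / 2 - b) ^ 2 / ((n : ℝ) + 1 / 2) ^ 2 := by positivity
            linarith))
        · have := Real.one_sub_inv_le_log_of_pos (hpos n)
          have e : (1 - (1 / 2 - b) ^ 2 / ((n : ℝ) + 1 / 2) ^ 2)⁻¹ - 1
              = (1 / 2 - b) ^ 2 / ((n + b) * (n + (1 - b))) := by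
            have hd := (hden n).ne'
            have hn : ((n : ℝ) + 1 / 2) ≠ 0 := by positivity
            have : 1 - (1 / 2 - b) ^ 2 / ((n : ℝ) + 1 / 2) ^ 2
                = ((n + b) * (n + (1 - b))) / ((n : ℝ) + 1 / 2) ^ 2 := by
              field_simp
              ring
            rw [this, inv_div, eq_div_iff hd, sub_mul, div_mul_cancel₀ _ hd]
            ring
          have e2 : (1 / 2 - b) ^ 2 / ((n + b) * (n + (1 - b)))
              ≤ 1 / ((n + b) * ((n : ℝ) + (1 - b))) := by
            gcongr
            nlinarith
          simp only [hg]
          linarith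
      have ht := hsum.hasSum.tendsto_sum_nat
      have hc := tendsto_prod_one_sub_sq_div_half hx
      have hcos : Real.cos (Real.pi * (1 / 2 - b)) = Real.sin (Real.pi * b) := by
        rw [← Real.cos_pi_div_two_sub]
        ring_nf
      rw [hcos] at hc
      have hsin : 0 < Real.sin (Real.pi * b) :=
        Real.sin_pos_of_pos_of_lt_pi (by positivity) (by nlinarith [Real.pi_pos])
      refine tendsto_nhds_unique ht
        (((Real.continuousAt_log hsin.ne').tendsto.comp hc).neg.congr fun N => ?_)
      rw [Function.comp_apply, Real.log_prod fun n _ => (hpos n).ne', hg, Finset.sum_neg_distrib]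
    rw [hval] at hlim
    refine hlim.congr' ?_
    filter_upwards [self_mem_nhdsWithin] with s hs
    have hs : 0 < s := hs
    have s1 := summable_eulerLog hb0 hs
    have s2 := summable_eulerLog (b := 1 - b) (by linarith) hs
    have s3 := summable_eulerLog (b := 1 / 2) (by norm_num) hs
    rw [(s1.add s2).tsum_sub (s3.mul_left 2), s1.tsum_add s2, tsum_mul_left]
    rfl
  · intro n
    have h1 := tendsto_eulerLog_mul_add_log (c := n + b) (by positivity)
    have h2 := tendsto_eulerLog_mul_add_log (c := n + (1 - b))
      (add_pos_of_nonneg_of_pos (Nat.cast_nonneg n) (by linarith))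
    have h3 := tendsto_eulerLog_mul_add_log (c := n + 1 / 2) (by positivity)
    have h := (h1.add h2).sub (h3.const_mul 2)
    have e : -Real.log (n + b) + -Real.log (n + (1 - b)) - 2 * -Real.log ((n : ℝ) + 1 / 2) = g n := by
      have hn : ((n : ℝ) + 1 / 2) ≠ 0 := by positivity
      have : 1 - (1 / 2 - b) ^ 2 / ((n : ℝ) + 1 / 2) ^ 2
          = ((n + b) * (n + (1 - b))) / ((n : ℝ) + 1 / 2) ^ 2 := by
        field_simp
        ring
      have hp := hden n
      simp only [hg]
      rw [this, Real.log_div hp.ne' (by positivity), Real.log_pow,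
        Real.log_mul (left_ne_zero_of_mul hp.ne') (right_ne_zero_of_mul hp.ne')]
      push_cast
      ring
    rw [e] at h
    exact h.congr fun s => by ring
  · filter_upwards [Ioo_mem_nhdsGT (one_pos (α := ℝ))] with s hs n
    obtain ⟨hs0, hs1⟩ := hs
    have hd : |(1 / 2 - b) * s| < ((n : ℝ) + 1 / 2) * s := by
      rw [abs_mul, abs_of_pos hs0]
      have : (0 : ℝ) ≤ n := Nat.cast_nonneg n
      gcongr
      linarith
    have hd1 : |(1 / 2 - b) * s| ≤ 1 := by
      rw [abs_mul, abs_of_pos hs0]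
      nlinarith [abs_nonneg (1 / 2 - b)]
    have h := abs_eulerLog_second_difference_le hd hd1
    rw [Real.norm_eq_abs]
    have e1 : ((n : ℝ) + 1 / 2) * s - (1 / 2 - b) * s = (n + b) * s := by ring
    have e2 : ((n : ℝ) + 1 / 2) * s + (1 / 2 - b) * s = (n + (1 - b)) * s := by ring
    rw [e1, e2] at h
    refine h.trans ?_
    have hp := hden n
    rw [div_le_div_iff₀ (by nlinarith [mul_pos hp (mul_pos hs0 hs0)]) hp, one_mul]
    have : (1 / 2 - b) ^ 2 ≤ 1 / 4 := by nlinarith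
    have h5 : 4 * ((1 / 2 - b) * s) ^ 2 ≤ s ^ 2 := by nlinarith [sq_nonneg s]
    nlinarith [mul_le_mul_of_nonneg_right h5 hp.le]

/-- The behaviour of `∏_{k ≥ 0} ((1 - e^{-(k+b)s}) (1 - e^{-(k+1-b)s}))⁻¹` as `s → 0⁺`. -/
theorem tendsto_logProgressionGF_pair {b : ℝ} (hb0 : 0 < b) (hb1 : b < 1) :
    Tendsto (fun s => logProgressionGF b s + logProgressionGF (1 - b) s - Real.pi ^ 2 / (3 * s))
      (𝓝[>] 0) (𝓝 (-Real.log 2 - Real.log (Real.sin (Real.pi * b)))) := by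
  have h := (tendsto_logProgressionGF_add hb0 hb1).add (tendsto_logProgressionGF_half.const_mul 2)
  have e : -Real.log (Real.sin (Real.pi * b)) + 2 * -(Real.log 2 / 2)
      = -Real.log 2 - Real.log (Real.sin (Real.pi * b)) := by ring
  rw [e] at h
  refine h.congr' ?_
  filter_upwards [self_mem_nhdsWithin] with s hs
  have hs : s ≠ 0 := (show 0 < s from hs).ne'
  field_simp
  ring

/-- The pairs `1 ≤ i < j ≤ m - 1`. -/
def widthPairs (m : ℕ) : Finset (ℕ × ℕ) :=
  (Finset.Icc 1 (m - 1) ×ˢ Finset.Icc 1 (m - 1)).filter fun p => p.1 < p.2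

theorem mem_widthPairs {m : ℕ} {p : ℕ × ℕ} :
    p ∈ widthPairs m ↔ 1 ≤ p.1 ∧ p.1 < p.2 ∧ p.2 < m := by
  simp only [widthPairs, Finset.mem_filter, Finset.mem_product, Finset.mem_Icc]
  omega

theorem card_widthPairs {m : ℕ} (hm : 1 ≤ m) :
    ((widthPairs m).card : ℝ) = ((m : ℝ) - 1) * (m - 2) / 2 := by
  induction m, hm using Nat.le_induction with
  | base => simp [widthPairs]
  | succ m hm ih =>
    have : widthPairs (m + 1) = (widthPairs m).disjUnion (Finset.Icc 1 (m - 1) ×ˢ {m}) (by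
        rw [Finset.disjoint_left]
        intro p hp
        rw [mem_widthPairs] at hp
        simp only [Finset.mem_product, Finset.mem_singleton]
        omega) := by
      ext p
      simp only [Finset.mem_disjUnion, mem_widthPairs, Finset.mem_product, Finset.mem_Icc,
        Finset.mem_singleton]
      omega
    rw [this, Finset.card_disjUnion, Finset.card_product, Nat.card_Icc, Nat.cast_add, ih]
    simp only [Nat.add_sub_cancel, Finset.card_singleton, mul_one]
    rw [Nat.cast_sub hm]
    push_cast
    ring

/-- The symmetry `(i, j) ↦ (m - j, m - i)` of the pairs. -/
theorem sum_widthPairs_reflect {m : ℕ} (q : ℕ → Prop) [DecidablePred q] (f : ℕ → ℝ) :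
    ∑ p ∈ (widthPairs m).filter (fun p => q (2 * m - (p.1 + p.2))), f (2 * m - (p.1 + p.2))
      = ∑ p ∈ (widthPairs m).filter (fun p => q (p.1 + p.2)), f (p.1 + p.2) := by
  refine Finset.sum_bij' (fun p _ => (m - p.2, m - p.1)) (fun p _ => (m - p.2, m - p.1))
    ?_ ?_ ?_ ?_ ?_
  · intro p hp
    simp only [Finset.mem_filter, mem_widthPairs] at hp ⊢
    refine ⟨by omega, ?_⟩
    rw [show m - p.2 + (m - p.1) = 2 * m - (p.1 + p.2) by omega]
    exact hp.2
  · intro p hp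
    simp only [Finset.mem_filter, mem_widthPairs] at hp ⊢
    refine ⟨by omega, ?_⟩
    rw [show 2 * m - (m - p.2 + (m - p.1)) = p.1 + p.2 by omega]
    exact hp.2
  · intro p hp
    simp only [Finset.mem_filter, mem_widthPairs] at hp
    ext <;> simp <;> omega
  · intro p hp
    simp only [Finset.mem_filter, mem_widthPairs] at hp
    ext <;> simp <;> omega
  · intro p hp
    simp only [Finset.mem_filter, mem_widthPairs] at hp
    congr 1
    omega

theorem sum_widthPairs_log_sin (m : ℕ) :
    ∑ p ∈ widthPairs m, Real.log (Real.sin (Real.pi * (((p.1 + p.2 : ℕ) : ℝ) / (2 * m))))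
      = 2 * ∑ i ∈ Finset.Icc 1 (m - 2), ∑ j ∈ Finset.Icc (i + 1) (m - i - 1),
        Real.log (Real.sin (((i : ℝ) + (j : ℝ)) * Real.pi / (2 * m))) := by
  set g : ℕ → ℝ := fun n => Real.log (Real.sin (Real.pi * ((n : ℝ) / (2 * m)))) with hg
  have hrefl : ∀ p ∈ widthPairs m, g (2 * m - (p.1 + p.2)) = g (p.1 + p.2) := by
    intro p hp
    rw [mem_widthPairs] at hp
    have hm : (m : ℝ) ≠ 0 := by
      have : m ≠ 0 := by omega
      exact_mod_cast this
    simp only [hg]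
    rw [Nat.cast_sub (by omega), ← Real.sin_pi_sub]
    congr 2
    push_cast
    field_simp
    ring
  have hsplit : ∑ p ∈ widthPairs m, g (p.1 + p.2)
      = ∑ p ∈ (widthPairs m).filter (fun p => p.1 + p.2 < m), g (p.1 + p.2)
        + ∑ p ∈ (widthPairs m).filter (fun p => m < p.1 + p.2), g (p.1 + p.2) := by
    rw [← Finset.sum_filter_add_sum_filter_not (widthPairs m) (fun p => p.1 + p.2 < m)]
    congr 1
    symm
    refine Finset.sum_subset (fun p hp => ?_) (fun p hp hp' => ?_)
    · simp only [Finset.mem_filter] at hp ⊢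
      exact ⟨hp.1, by omega⟩
    · simp only [Finset.mem_filter, mem_widthPairs] at hp hp'
      have hpm : p.1 + p.2 = m := by
        by_contra h
        exact hp' ⟨hp.1, by omega⟩
      have hm : (m : ℝ) ≠ 0 := by
        have : m ≠ 0 := by omega
        exact_mod_cast this
      simp only [hg, hpm]
      rw [show Real.pi * ((m : ℝ) / (2 * m)) = Real.pi / 2 by field_simp, Real.sin_pi_div_two,
        Real.log_one]
  have hgt : ∑ p ∈ (widthPairs m).filter (fun p => m < p.1 + p.2), g (p.1 + p.2)
      = ∑ p ∈ (widthPairs m).filter (fun p => p.1 + p.2 < m), g (p.1 + p.2) := by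
    rw [← sum_widthPairs_reflect (fun n => m < n)]
    refine Finset.sum_congr ?_ fun p hp => hrefl p (Finset.mem_filter.1 hp).1
    ext p
    simp only [Finset.mem_filter, mem_widthPairs]
    omega
  have hlt : ∑ p ∈ (widthPairs m).filter (fun p => p.1 + p.2 < m), g (p.1 + p.2)
      = ∑ i ∈ Finset.Icc 1 (m - 2), ∑ j ∈ Finset.Icc (i + 1) (m - i - 1), g (i + j) := by
    refine Finset.sum_finset_product _ _ _ fun p => ?_
    simp only [Finset.mem_filter, mem_widthPairs, Finset.mem_Icc]
    omega
  rw [hsplit, hgt, hlt, ← two_mul]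
  congr 1
  refine Finset.sum_congr rfl fun i _ => Finset.sum_congr rfl fun j _ => ?_
  simp only [hg]
  push_cast
  ring_nf

/-- The logarithm of the product formula for doubled shifted plane partitions of width `m`,
at `e^{-s}`. -/
noncomputable def logDSPPGF (m : ℕ) (s : ℝ) : ℝ :=
  logPartitionGF s +
    ∑ p ∈ widthPairs m, logProgressionGF (((p.1 + p.2 : ℕ) : ℝ) / (2 * m)) (2 * m * s)

theorem tendsto_logDSPPGF {m : ℕ} (hm : 1 ≤ m) :
    Tendsto (fun s => logDSPPGF m s - Real.pi ^ 2 * ((m : ℝ) ^ 2 + m + 2) / (24 * m) / s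
        - Real.log s / 2) (𝓝[>] 0)
      (𝓝 (-(Real.log (2 * Real.pi) / 2) - ((m : ℝ) - 1) * (m - 2) / 4 * Real.log 2
        - ∑ i ∈ Finset.Icc 1 (m - 2), ∑ j ∈ Finset.Icc (i + 1) (m - i - 1),
          Real.log (Real.sin (((i : ℝ) + (j : ℝ)) * Real.pi / (2 * m))))) := by
  have hm0 : (0 : ℝ) < m := by exact_mod_cast hm
  have hscale : Tendsto (fun s : ℝ => 2 * m * s) (𝓝[>] 0) (𝓝[>] 0) := by
    refine tendsto_nhdsWithin_iff.2 ⟨?_, ?_⟩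
    · have : Tendsto (fun s : ℝ => 2 * m * s) (𝓝 0) (𝓝 (2 * m * 0)) := tendsto_id.const_mul _
      rw [mul_zero] at this
      exact this.mono_left nhdsWithin_le_nhds
    · filter_upwards [self_mem_nhdsWithin] with s hs
      exact mul_pos (by positivity) (show 0 < s from hs)
  have hpair : Tendsto (fun s => ∑ p ∈ widthPairs m,
      (logProgressionGF (((p.1 + p.2 : ℕ) : ℝ) / (2 * m)) (2 * m * s)
        + logProgressionGF (1 - ((p.1 + p.2 : ℕ) : ℝ) / (2 * m)) (2 * m * s)
        - Real.pi ^ 2 / (3 * (2 * m * s)))) (𝓝[>] 0)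
      (𝓝 (∑ p ∈ widthPairs m, (-Real.log 2
        - Real.log (Real.sin (Real.pi * (((p.1 + p.2 : ℕ) : ℝ) / (2 * m))))))) := by
    refine tendsto_finsetSum _ fun p hp => ?_
    rw [mem_widthPairs] at hp
    have h1 : (0 : ℝ) < ((p.1 + p.2 : ℕ) : ℝ) := by
      have : 0 < p.1 + p.2 := by omega
      exact_mod_cast this
    have h2 : ((p.1 + p.2 : ℕ) : ℝ) < 2 * m := by
      have : p.1 + p.2 < 2 * m := by omega
      exact_mod_cast this
    exact (tendsto_logProgressionGF_pair (b := ((p.1 + p.2 : ℕ) : ℝ) / (2 * m)) (by positivity)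
      ((div_lt_one (by positivity)).2 h2)).comp hscale
  have h := tendsto_logPartitionGF.add (hpair.div_const 2)
  simp only [Finset.sum_sub_distrib, sum_widthPairs_log_sin, Finset.sum_const, nsmul_eq_mul,
    card_widthPairs hm] at h
  convert h.congr' ?_ using 2
  · ring
  filter_upwards [self_mem_nhdsWithin] with s hs
  have hs : s ≠ 0 := (show 0 < s from hs).ne'
  have hsum : ∑ p ∈ widthPairs m,
      logProgressionGF (1 - ((p.1 + p.2 : ℕ) : ℝ) / (2 * m)) (2 * m * s)
      = ∑ p ∈ widthPairs m, logProgressionGF (((p.1 + p.2 : ℕ) : ℝ) / (2 * m)) (2 * m * s) := by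
    have := sum_widthPairs_reflect (m := m) (fun _ => True)
      (fun n => logProgressionGF ((n : ℝ) / (2 * m)) (2 * m * s))
    simp only [Finset.filter_true] at this
    rw [← this]
    refine Finset.sum_congr rfl fun p hp => ?_
    rw [mem_widthPairs] at hp
    rw [Nat.cast_sub (by omega)]
    congr 1
    push_cast
    field_simp
  rw [Finset.sum_add_distrib, hsum, logDSPPGF]
  field_simp
  ring

section ExponentialSums

variable {ι : Type*} (w : ι → ℝ) (e : ι → ℕ)

/-- The exponential sum `∑ w_i exp (-e_i z)`. -/
noncomputable def expSum (z : ℂ) : ℂ := ∑' i, (w i : ℂ) * Complex.exp (-(e i * z))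

/-- The moment `∑ w_i e_i^k exp (-e_i s)`. -/
noncomputable def expMoment (k : ℕ) (s : ℝ) : ℝ := ∑' i, w i * (e i : ℝ) ^ k * Real.exp (-(e i * s))

variable {w e}

theorem expMoment_term_le (hw : ∀ i, 0 ≤ w i) (k : ℕ) {s : ℝ} (hs : 0 < s) (i : ι) :
    w i * (e i : ℝ) ^ k * Real.exp (-(e i * s)) ≤
      k.factorial * (2 / s) ^ k * (w i * (e i : ℝ) ^ 0 * Real.exp (-(e i * (s / 2)))) := by
  have h := Real.pow_div_factorial_le_exp (e i * (s / 2)) (by positivity) k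
  rw [div_le_iff₀ (by positivity)] at h
  have h2 : Real.exp (-(e i * s)) = Real.exp (-(e i * (s / 2))) * Real.exp (-(e i * (s / 2))) := by
    rw [← Real.exp_add]
    ring_nf
  have h3 : Real.exp (e i * (s / 2)) * Real.exp (-(e i * (s / 2))) = 1 := by
    rw [← Real.exp_add]
    simp
  have h4 : (e i : ℝ) ^ k = (e i * (s / 2)) ^ k * (2 / s) ^ k := by
    rw [← mul_pow]
    congr 1
    field_simp
  have h5 : 0 ≤ w i * (2 / s) ^ k * Real.exp (-(e i * (s / 2))) * Real.exp (-(e i * (s / 2))) := by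
    have := hw i
    positivity
  rw [h4, h2]
  calc _ = (e i * (s / 2)) ^ k * (w i * (2 / s) ^ k * Real.exp (-(e i * (s / 2)))
        * Real.exp (-(e i * (s / 2)))) := by ring
    _ ≤ (Real.exp (e i * (s / 2)) * k.factorial) * (w i * (2 / s) ^ k
        * Real.exp (-(e i * (s / 2))) * Real.exp (-(e i * (s / 2)))) := by gcongr
    _ = k.factorial * (2 / s) ^ k * (w i * Real.exp (-(e i * (s / 2)))) *
        (Real.exp (e i * (s / 2)) * Real.exp (-(e i * (s / 2)))) := by ring
    _ = _ := by rw [h3]; ring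

theorem summable_expMoment (hw : ∀ i, 0 ≤ w i)
    (hsum : ∀ s : ℝ, 0 < s → Summable fun i => w i * Real.exp (-(e i * s))) (k : ℕ) {s : ℝ}
    (hs : 0 < s) : Summable fun i => w i * (e i : ℝ) ^ k * Real.exp (-(e i * s)) := by
  refine Summable.of_nonneg_of_le (fun i => ?_) (expMoment_term_le hw k hs) ?_
  · have := hw i
    positivity
  · simpa using (hsum (s / 2) (by positivity)).mul_left (k.factorial * (2 / s) ^ k)

theorem expMoment_le (hw : ∀ i, 0 ≤ w i)
    (hsum : ∀ s : ℝ, 0 < s → Summable fun i => w i * Real.exp (-(e i * s))) (k : ℕ) {s : ℝ}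
    (hs : 0 < s) : expMoment w e k s ≤ k.factorial * (2 / s) ^ k * expMoment w e 0 (s / 2) := by
  rw [expMoment, expMoment, ← tsum_mul_left]
  exact (summable_expMoment hw hsum k hs).tsum_le_tsum (expMoment_term_le hw k hs)
    ((summable_expMoment hw hsum 0 (by positivity)).mul_left _)

theorem norm_expSum_term (hw : ∀ i, 0 ≤ w i) (z : ℂ) (i : ι) :
    ‖(w i : ℂ) * Complex.exp (-(e i * z))‖ = w i * Real.exp (-(e i * z.re)) := by
  rw [norm_mul, Complex.norm_real, Real.norm_of_nonneg (hw i), Complex.norm_exp]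
  simp

theorem summable_expSum (hw : ∀ i, 0 ≤ w i)
    (hsum : ∀ s : ℝ, 0 < s → Summable fun i => w i * Real.exp (-(e i * s))) {z : ℂ}
    (hz : 0 < z.re) : Summable fun i => (w i : ℂ) * Complex.exp (-(e i * z)) :=
  Summable.of_norm (by simpa only [norm_expSum_term hw] using hsum z.re hz)

theorem expSum_ofReal (s : ℝ) : expSum w e s = (expMoment w e 0 s : ℝ) := by
  rw [expSum, expMoment, Complex.ofReal_tsum]
  simp

/-- Second order Taylor expansion of an exponential sum. -/
theorem norm_expSum_taylor_le (hw : ∀ i, 0 ≤ w i)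
    (hsum : ∀ s : ℝ, 0 < s → Summable fun i => w i * Real.exp (-(e i * s))) {s : ℝ} (hs : 0 < s)
    {h : ℂ} (hh : ‖h‖ ≤ s / 2) :
    ‖expSum w e (s - h) - expSum w e s - h * expMoment w e 1 s - h ^ 2 / 2 * expMoment w e 2 s‖
      ≤ ‖h‖ ^ 3 * (384 / s ^ 3 * expMoment w e 0 (s / 4)) := by
  have hre : 0 < ((s : ℂ) - h).re := by
    have := (abs_le.1 (Complex.abs_re_le_norm h)).2
    simp only [Complex.sub_re, Complex.ofReal_re]
    linarith
  have s0 := summable_expSum hw hsum (z := s) (by simpa using hs)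
  have s1 := summable_expSum hw hsum hre
  have sk : ∀ k, Summable fun i => (((w i * (e i : ℝ) ^ k * Real.exp (-(e i * s)) : ℝ)) : ℂ) :=
    fun k => Complex.summable_ofReal.2 (summable_expMoment hw hsum k hs)
  have hmom : ∀ k, (expMoment w e k s : ℂ)
      = ∑' i, (((w i * (e i : ℝ) ^ k * Real.exp (-(e i * s)) : ℝ)) : ℂ) := fun k => by
    rw [expMoment, Complex.ofReal_tsum]
  rw [hmom, hmom, expSum, expSum, ← tsum_mul_left, ← tsum_mul_left, ← s1.tsum_sub s0,
    ← (s1.sub s0).tsum_sub ((sk 1).mul_left _),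
    ← ((s1.sub s0).sub ((sk 1).mul_left _)).tsum_sub ((sk 2).mul_left _)]
  have s3 := summable_expMoment hw hsum 3 (half_pos hs)
  have hterm : ∀ i, ‖(w i : ℂ) * Complex.exp (-(e i * (s - h))) - (w i : ℂ) * Complex.exp (-(e i * s))
      - h * ((w i * (e i : ℝ) ^ 1 * Real.exp (-(e i * s)) : ℝ))
      - h ^ 2 / 2 * ((w i * (e i : ℝ) ^ 2 * Real.exp (-(e i * s)) : ℝ))‖
      ≤ ‖h‖ ^ 3 * (w i * (e i : ℝ) ^ 3 * Real.exp (-(e i * (s / 2)))) := by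
    intro i
    have hx := Complex.norm_exp_sub_sum_le_norm_mul_exp (e i * h) 3
    simp only [Finset.sum_range_succ, Finset.sum_range_zero, Nat.factorial] at hx
    have heq : (w i : ℂ) * Complex.exp (-(e i * (s - h))) - (w i : ℂ) * Complex.exp (-(e i * s))
        - h * ((w i * (e i : ℝ) ^ 1 * Real.exp (-(e i * s)) : ℝ))
        - h ^ 2 / 2 * ((w i * (e i : ℝ) ^ 2 * Real.exp (-(e i * s)) : ℝ))
        = ((w i * Real.exp (-(e i * s)) : ℝ) : ℂ) * (Complex.exp (e i * h) - (0 + (e i * h) ^ 0 / (1 : ℕ)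
          + (e i * h) ^ 1 / (((0 + 1) * 1 : ℕ) : ℂ)
          + (e i * h) ^ 2 / (((1 + 1) * ((0 + 1) * 1) : ℕ) : ℂ))) := by
      rw [show (-(e i * ((s : ℂ) - h))) = -(e i * s) + e i * h by ring, Complex.exp_add]
      push_cast
      ring
    rw [heq, norm_mul, Complex.norm_real, Real.norm_of_nonneg (mul_nonneg (hw i) (Real.exp_pos _).le)]
    have hn : ‖(e i : ℂ) * h‖ = e i * ‖h‖ := by simp
    rw [hn] at hx
    have hle : Real.exp (e i * ‖h‖) ≤ Real.exp (e i * (s / 2)) := by gcongr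
    have hexp : Real.exp (-(e i * s)) * Real.exp (e i * (s / 2)) = Real.exp (-(e i * (s / 2))) := by
      rw [← Real.exp_add]
      ring_nf
    calc _ ≤ (w i * Real.exp (-(e i * s))) * ((e i * ‖h‖) ^ 3 * Real.exp (e i * ‖h‖)) :=
          mul_le_mul_of_nonneg_left hx (mul_nonneg (hw i) (Real.exp_pos _).le)
      _ ≤ (w i * Real.exp (-(e i * s))) * ((e i * ‖h‖) ^ 3 * Real.exp (e i * (s / 2))) := by
          have := hw i
          gcongr
      _ = ‖h‖ ^ 3 * (w i * (e i : ℝ) ^ 3 * (Real.exp (-(e i * s)) * Real.exp (e i * (s / 2)))) := by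
          ring
      _ = _ := by rw [hexp]
  refine (tsum_of_norm_bounded (s3.mul_left (‖h‖ ^ 3)).hasSum hterm).trans ?_
  rw [tsum_mul_left]
  have hm := expMoment_le hw hsum 3 (half_pos hs)
  rw [show s / 2 / 2 = s / 4 by ring] at hm
  have hc : ((Nat.factorial 3 : ℕ) : ℝ) * (2 / (s / 2)) ^ 3 = 384 / s ^ 3 := by
    simp only [Nat.factorial]
    push_cast
    field_simp
    norm_num
  rw [hc] at hm
  exact mul_le_mul_of_nonneg_left hm (by positivity)

variable {A κ : ℝ}

theorem tendsto_mul_expMoment_zero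
    (hL : Tendsto (fun s => expMoment w e 0 s - A / s - Real.log s / 2) (𝓝[>] 0) (𝓝 κ)) :
    Tendsto (fun s => s * expMoment w e 0 s) (𝓝[>] 0) (𝓝 A) := by
  have hid : Tendsto (fun s : ℝ => s) (𝓝[>] 0) (𝓝 0) := tendsto_id.mono_left nhdsWithin_le_nhds
  have h1 := hid.mul hL
  have h2 : Tendsto (fun s : ℝ => s * (Real.log s / 2)) (𝓝[>] 0) (𝓝 0) := by
    have := (Real.continuous_mul_log.tendsto 0).div_const 2
    simp only [zero_mul, zero_div] at this
    exact (this.mono_left nhdsWithin_le_nhds).congr fun s => by ring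
  have h3 := (h1.add h2).add_const A
  simp only [zero_mul, zero_add] at h3
  refine h3.congr' ?_
  filter_upwards [self_mem_nhdsWithin] with s hs
  have hs : s ≠ 0 := (show 0 < s from hs).ne'
  field_simp
  ring

theorem tendsto_sq_nhdsGT_zero : Tendsto (fun r : ℝ => r ^ 2) (𝓝[>] 0) (𝓝[>] 0) := by
  refine tendsto_nhdsWithin_iff.2 ⟨?_, ?_⟩
  · have : Tendsto (fun r : ℝ => r ^ 2) (𝓝 0) (𝓝 (0 ^ 2)) := tendsto_id.pow 2
    rw [zero_pow two_ne_zero] at this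
    exact this.mono_left nhdsWithin_le_nhds
  · filter_upwards [self_mem_nhdsWithin] with r hr
    exact pow_pos (show 0 < r from hr) 2

/-- At the scale `h = c r³`, the third order error at `s = r²` is negligible. -/
theorem tendsto_expSum_taylor (hw : ∀ i, 0 ≤ w i)
    (hsum : ∀ s : ℝ, 0 < s → Summable fun i => w i * Real.exp (-(e i * s)))
    (hL : Tendsto (fun s => expMoment w e 0 s - A / s - Real.log s / 2) (𝓝[>] 0) (𝓝 κ)) (c : ℂ) :
    Tendsto (fun r : ℝ => expSum w e ((r ^ 2 : ℝ) - c * r ^ 3) - expSum w e (r ^ 2 : ℝ)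
      - c * r ^ 3 * expMoment w e 1 (r ^ 2) - (c * r ^ 3) ^ 2 / 2 * expMoment w e 2 (r ^ 2))
      (𝓝[>] 0) (𝓝 0) := by
  have hid : Tendsto (fun s : ℝ => s) (𝓝[>] 0) (𝓝 0) := tendsto_id.mono_left nhdsWithin_le_nhds
  have hq : Tendsto (fun r : ℝ => r ^ 2 / 4) (𝓝[>] 0) (𝓝[>] 0) := by
    refine tendsto_nhdsWithin_iff.2 ⟨?_, ?_⟩
    · simpa using (hid.pow 2).div_const 4
    · filter_upwards [self_mem_nhdsWithin] with r hr
      have : 0 < r := hr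
      exact (by positivity : 0 < r ^ 2 / 4)
  have hb := (hid.const_mul (‖c‖ ^ 3 * 1536)).mul ((tendsto_mul_expMoment_zero hL).comp hq)
  rw [mul_zero, zero_mul] at hb
  refine squeeze_zero_norm' ?_ hb
  have hsmall : ∀ᶠ r : ℝ in 𝓝[>] 0, ‖c‖ * r < 1 / 2 := by
    have := hid.const_mul ‖c‖
    rw [mul_zero] at this
    exact this.eventually_lt_const (by norm_num)
  filter_upwards [self_mem_nhdsWithin, hsmall] with r hr hrc
  have hr : 0 < r := hr
  have hn : ‖c * (r : ℂ) ^ 3‖ = ‖c‖ * r ^ 3 := by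
    rw [norm_mul, norm_pow, Complex.norm_real, Real.norm_of_nonneg hr.le]
  refine (norm_expSum_taylor_le hw hsum (s := r ^ 2) (by positivity) (h := c * r ^ 3) ?_).trans ?_
  · rw [hn]
    nlinarith [mul_pos hr hr]
  · rw [hn, Function.comp_apply]
    apply le_of_eq
    field_simp
    ring

theorem tendsto_expMoment_one_two (hw : ∀ i, 0 ≤ w i)
    (hsum : ∀ s : ℝ, 0 < s → Summable fun i => w i * Real.exp (-(e i * s)))
    (hL : Tendsto (fun s => expMoment w e 0 s - A / s - Real.log s / 2) (𝓝[>] 0) (𝓝 κ)) :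
    Tendsto (fun r : ℝ => r ^ 3 * expMoment w e 1 (r ^ 2) - A / r) (𝓝[>] 0) (𝓝 0) ∧
    Tendsto (fun r : ℝ => r ^ 6 * expMoment w e 2 (r ^ 2)) (𝓝[>] 0) (𝓝 (2 * A)) := by
  have hid : Tendsto (fun s : ℝ => s) (𝓝[>] 0) (𝓝 0) := tendsto_id.mono_left nhdsWithin_le_nhds
  have hreal : ∀ c : ℝ, Tendsto (fun r : ℝ => expMoment w e 0 (r ^ 2 - c * r ^ 3)
      - expMoment w e 0 (r ^ 2) - c * r ^ 3 * expMoment w e 1 (r ^ 2)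
      - (c * r ^ 3) ^ 2 / 2 * expMoment w e 2 (r ^ 2)) (𝓝[>] 0) (𝓝 0) := by
    intro c
    have h := (Complex.continuous_re.tendsto 0).comp (tendsto_expSum_taylor hw hsum hL c)
    rw [Complex.zero_re] at h
    refine h.congr fun r => ?_
    rw [Function.comp_apply, ← Complex.ofReal_re (_ - _)]
    congr 1
    push_cast
    rw [← expSum_ofReal, ← expSum_ofReal]
    push_cast
    ring
  have hr1 : ∀ᶠ r : ℝ in 𝓝[>] 0, r ∈ Set.Ioo (0 : ℝ) 1 := Ioo_mem_nhdsGT one_pos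
  have hmain : Tendsto (fun r : ℝ => expMoment w e 0 (r ^ 2) - A / r ^ 2 - Real.log r) (𝓝[>] 0)
      (𝓝 κ) := by
    refine (hL.comp tendsto_sq_nhdsGT_zero).congr fun r => ?_
    rw [Function.comp_apply, Real.log_pow]
    push_cast
    ring
  have hshift : ∀ c : ℝ, |c| ≤ 1 → Tendsto (fun r : ℝ => expMoment w e 0 (r ^ 2 - c * r ^ 3)
      - A / (r ^ 2 * (1 - c * r)) - Real.log r) (𝓝[>] 0) (𝓝 κ) := by
    intro c hc
    have hlim : Tendsto (fun r : ℝ => 1 - c * r) (𝓝[>] 0) (𝓝 1) := by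
      simpa using (hid.const_mul c).const_sub 1
    have hs : Tendsto (fun r : ℝ => r ^ 2 * (1 - c * r)) (𝓝[>] 0) (𝓝[>] 0) := by
      refine tendsto_nhdsWithin_iff.2 ⟨by simpa using (hid.pow 2).mul hlim, ?_⟩
      filter_upwards [hr1] with r hr
      have : 0 < 1 - c * r := by nlinarith [(abs_le.1 hc).2, hr.1, hr.2]
      have := hr.1
      exact (by positivity : 0 < r ^ 2 * (1 - c * r))
    have hlog : Tendsto (fun r : ℝ => Real.log (1 - c * r) / 2) (𝓝[>] 0) (𝓝 0) := by
      have := ((Real.continuousAt_log one_ne_zero).tendsto.comp hlim).div_const 2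
      simpa using this
    have h := (hL.comp hs).add hlog
    rw [add_zero] at h
    refine h.congr' ?_
    filter_upwards [hr1] with r hr
    have h1 : 0 < 1 - c * r := by nlinarith [(abs_le.1 hc).2, hr.1, hr.2]
    have h2 := hr.1
    rw [Function.comp_apply, Real.log_mul (by positivity) h1.ne', Real.log_pow,
      show r ^ 2 * (1 - c * r) = r ^ 2 - c * r ^ 3 by ring]
    push_cast
    ring
  have p1 := hshift 1 (by norm_num)
  have p2 := hshift (-1) (by norm_num)
  have t1 := hreal 1
  have t2 := hreal (-1)
  have hsq : Tendsto (fun r : ℝ => 1 - r ^ 2) (𝓝[>] 0) (𝓝 1) := by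
    simpa using (hid.pow 2).const_sub 1
  have hz1 : Tendsto (fun r : ℝ => A * r / (1 - r ^ 2)) (𝓝[>] 0) (𝓝 0) := by
    simpa [div_eq_mul_inv] using (hid.const_mul A).mul (hsq.inv₀ one_ne_zero)
  have hz2 : Tendsto (fun r : ℝ => 2 * A / (1 - r ^ 2)) (𝓝[>] 0) (𝓝 (2 * A)) := by
    simpa [div_eq_mul_inv] using (hsq.inv₀ one_ne_zero).const_mul (2 * A)
  constructor
  · have h := (((p1.sub p2).sub (t1.sub t2)).div_const 2).add hz1
    simp only [sub_self, zero_div, add_zero] at h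
    refine h.congr' ?_
    filter_upwards [hr1] with r hr
    have h1 : 1 - r ≠ 0 := by linarith [hr.2]
    have h2 : 1 + r ≠ 0 := by linarith [hr.1]
    have h3 : 1 - r ^ 2 ≠ 0 := by
      rw [show 1 - r ^ 2 = (1 - r) * (1 + r) by ring]
      exact mul_ne_zero h1 h2
    have h4 := hr.1.ne'
    have e1 : A / (r ^ 2 * (1 - 1 * r)) - A / (r ^ 2 * (1 - -1 * r)) = 2 * (A / r + A * r / (1 - r ^ 2)) := by
      rw [show 1 - 1 * r = 1 - r by ring, show 1 - -1 * r = 1 + r by ring]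
      field_simp
      ring
    linear_combination (-1 / 2 : ℝ) * e1
  · have h := (((p1.add p2).sub (hmain.const_mul 2)).sub (t1.add t2)).add hz2
    have e0 : κ + κ - 2 * κ - (0 + 0) + 2 * A = 2 * A := by ring
    rw [e0] at h
    refine h.congr' ?_
    filter_upwards [hr1] with r hr
    have h1 : 1 - r ≠ 0 := by linarith [hr.2]
    have h2 : 1 + r ≠ 0 := by linarith [hr.1]
    have h3 : 1 - r ^ 2 ≠ 0 := by
      rw [show 1 - r ^ 2 = (1 - r) * (1 + r) by ring]
      exact mul_ne_zero h1 h2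
    have h4 := hr.1.ne'
    have e1 : A / (r ^ 2 * (1 - 1 * r)) + A / (r ^ 2 * (1 - -1 * r)) - 2 * (A / r ^ 2)
        = 2 * A / (1 - r ^ 2) := by
      rw [show 1 - 1 * r = 1 - r by ring, show 1 - -1 * r = 1 + r by ring]
      field_simp
      ring
    linear_combination -e1

end ExponentialSums

section CoefficientExtraction

variable {ι : Type*} {w : ι → ℝ} {e : ι → ℕ} {c : ℕ → ℝ}

theorem differentiableOn_expSum (hw : ∀ i, 0 ≤ w i)
    (hsum : ∀ s : ℝ, 0 < s → Summable fun i => w i * Real.exp (-(e i * s))) :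
    DifferentiableOn ℂ (expSum w e) {z | 0 < z.re} := by
  intro z hz
  have hz : 0 < z.re := hz
  have hopen : IsOpen {y : ℂ | z.re / 2 < y.re} := isOpen_lt continuous_const Complex.continuous_re
  have h : DifferentiableOn ℂ (expSum w e) {y : ℂ | z.re / 2 < y.re} := by
    refine Complex.differentiableOn_tsum_of_summable_norm (hsum _ (half_pos hz)) (fun i => ?_) hopen
      fun i y hy => ?_
    · fun_prop
    · rw [norm_expSum_term hw]
      have := hw i
      have hy : z.re / 2 < y.re := hy
      gcongr
  exact (h.differentiableAt (hopen.mem_nhds (show z.re / 2 < z.re by linarith))).differentiableWithinAt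

theorem expSum_eq_exp_expSum (hw : ∀ i, 0 ≤ w i)
    (hsum : ∀ s : ℝ, 0 < s → Summable fun i => w i * Real.exp (-(e i * s)))
    (hc : ∀ n, 0 ≤ c n)
    (hgf : ∀ s : ℝ, 0 < s →
      HasSum (fun n => c n * Real.exp (-(n * s))) (Real.exp (expMoment w e 0 s)))
    {z : ℂ} (hz : 0 < z.re) : expSum c (fun n => n) z = Complex.exp (expSum w e z) := by
  have hopen : IsOpen {y : ℂ | 0 < y.re} := isOpen_lt continuous_const Complex.continuous_re
  have hconn : IsPreconnected {y : ℂ | 0 < y.re} :=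
    (convex_halfSpace_re_gt 0).isPreconnected
  have h1 := (differentiableOn_expSum (w := c) (e := fun n => n) hc
    fun s hs => (hgf s hs).summable).analyticOnNhd hopen
  have h2 := (differentiableOn_expSum hw hsum).cexp.analyticOnNhd hopen
  refine h1.eqOn_of_preconnected_of_frequently_eq h2 hconn (z₀ := 1) (by simp) ?_ hz
  have htend : Tendsto (fun s : ℝ => (s : ℂ)) (𝓝[≠] 1) (𝓝[≠] 1) := by
    refine tendsto_nhdsWithin_iff.2 ⟨?_, ?_⟩
    · have := Complex.continuous_ofReal.tendsto 1
      rw [Complex.ofReal_one] at this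
      exact this.mono_left nhdsWithin_le_nhds
    · filter_upwards [self_mem_nhdsWithin] with s hs
      simpa using hs
  refine htend.frequently (Eventually.frequently ?_)
  filter_upwards [nhdsWithin_le_nhds (Ioi_mem_nhds one_pos)] with s hs
  rw [expSum_ofReal, expSum_ofReal, ← Complex.ofReal_exp, ← (hgf s hs).tsum_eq, expMoment]
  simp

theorem integral_exp_int_mul_I (d : ℤ) :
    ∫ θ : ℝ in -Real.pi..Real.pi, Complex.exp (d * Complex.I * θ)
      = if d = 0 then 2 * (Real.pi : ℂ) else 0 := by
  split_ifs with h
  · simp [h]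
    ring
  · rw [integral_exp_mul_complex (mul_ne_zero (Int.cast_ne_zero.2 h) Complex.I_ne_zero)]
    have := Complex.exp_int_mul_two_pi_mul_I d
    rw [show (d : ℂ) * Complex.I * (Real.pi : ℝ)
      = d * Complex.I * ((-Real.pi : ℝ) : ℂ) + d * (2 * Real.pi * Complex.I) by push_cast; ring,
      Complex.exp_add, this]
    simp

theorem integral_expSum_mul_exp (hc : ∀ n, 0 ≤ c n)
    (hcs : ∀ s : ℝ, 0 < s → Summable fun n : ℕ => c n * Real.exp (-(n * s))) (n : ℕ) {s : ℝ}
    (hs : 0 < s) :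
    ∫ θ : ℝ in -Real.pi..Real.pi, expSum c (fun n => n) (s - Complex.I * θ)
        * Complex.exp (-(n * (Complex.I * θ)))
      = 2 * Real.pi * (c n * Real.exp (-(n * s)) : ℝ) := by
  have hre : ∀ θ : ℝ, ((s : ℂ) - Complex.I * θ).re = s := fun θ => by simp
  have h := intervalIntegral.hasSum_integral_of_dominated_convergence (a := -Real.pi)
    (b := Real.pi) (μ := MeasureTheory.volume)
    (F := fun (k : ℕ) (θ : ℝ) => ((c k : ℂ) * Complex.exp (-(k * (s - Complex.I * θ))))
        * Complex.exp (-(n * (Complex.I * θ))))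
    (f := fun θ => expSum c (fun n => n) (s - Complex.I * θ)
        * Complex.exp (-(n * (Complex.I * θ))))
    (fun k _ => c k * Real.exp (-(k * s)))
    (fun k => by
      apply Continuous.aestronglyMeasurable
      fun_prop)
    (fun k => Eventually.of_forall fun θ _ => by
      rw [norm_mul, norm_expSum_term (e := fun n : ℕ => n) hc, hre, Complex.norm_exp]
      simp)
    (Eventually.of_forall fun θ _ => hcs s hs)
    intervalIntegrable_const
    (Eventually.of_forall fun θ _ =>
      (summable_expSum (e := fun n : ℕ => n) hc hcs (by rw [hre]; exact hs)).hasSum.mul_right _)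
  refine h.unique ?_
  have hterm : ∀ k : ℕ, ∫ θ : ℝ in -Real.pi..Real.pi,
      ((c k : ℂ) * Complex.exp (-(k * (s - Complex.I * θ)))) * Complex.exp (-(n * (Complex.I * θ)))
      = if k = n then 2 * Real.pi * ((c n * Real.exp (-(n * s)) : ℝ) : ℂ) else 0 := by
    intro k
    have he : ∀ θ : ℝ, ((c k : ℂ) * Complex.exp (-(k * (s - Complex.I * θ))))
        * Complex.exp (-(n * (Complex.I * θ)))
        = ((c k * Real.exp (-(k * s)) : ℝ) : ℂ)
          * Complex.exp (((k - n : ℤ) : ℂ) * Complex.I * θ) := by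
      intro θ
      push_cast
      rw [mul_assoc, mul_assoc, ← Complex.exp_add, ← Complex.exp_add]
      ring_nf
    simp_rw [he]
    rw [intervalIntegral.integral_const_mul, integral_exp_int_mul_I]
    by_cases hkn : k = n
    · subst hkn
      simp
      ring
    · rw [if_neg hkn, if_neg (by omega), mul_zero]
  simp_rw [hterm]
  exact hasSum_ite_eq n _

end CoefficientExtraction

section MinorArc

theorem hasSum_geometric_mul_cos_sub_one {s : ℝ} (hs : 0 < s) (θ : ℝ) :
    HasSum (fun n : ℕ => Real.exp (-((n + 1 : ℕ) * s)) * (Real.cos ((n + 1 : ℕ) * θ) - 1))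
      (-(Real.exp (-s) * (1 + Real.exp (-s)) * (1 - Real.cos θ)) /
        ((1 - Real.exp (-s)) * ((1 - Real.exp (-s)) ^ 2 +
          2 * Real.exp (-s) * (1 - Real.cos θ)))) := by
  set q := Real.exp (-s) with hq
  have hq0 : 0 < q := Real.exp_pos _
  have hq1 : q < 1 := Real.exp_lt_one_iff.2 (by linarith)
  have hQ : ‖(q : ℂ) * Complex.exp (Complex.I * θ)‖ < 1 := by
    rw [norm_mul, Complex.norm_exp, Complex.norm_real, Real.norm_of_nonneg hq0.le]
    simpa using hq1
  have h1 := Complex.hasSum_re (hasSum_geometric_of_norm_lt_one hQ)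
  have h2 := hasSum_geometric_of_lt_one hq0.le hq1
  have h3 := (hasSum_nat_add_iff' 1).2 (h1.sub h2)
  have hden : 0 < (1 - q) ^ 2 + 2 * q * (1 - Real.cos θ) := by
    have := Real.cos_le_one θ
    have : 0 < 1 - q := by linarith
    have : 0 ≤ 1 - Real.cos θ := by linarith
    positivity
  convert h3 using 1
  · rfl
  · ext n
    rw [mul_pow, ← Complex.exp_nat_mul, ← Complex.ofReal_pow, Complex.re_ofReal_mul,
      show ((n + 1 : ℕ) : ℂ) * (Complex.I * θ) = (((n + 1 : ℕ) * θ : ℝ) : ℂ) * Complex.I by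
        push_cast; ring, Complex.exp_ofReal_mul_I_re, hq, ← Real.exp_nat_mul]
    ring_nf
  · have hinv : ((1 - (q : ℂ) * Complex.exp (Complex.I * θ))⁻¹).re
        = (1 - q * Real.cos θ) / ((1 - q) ^ 2 + 2 * q * (1 - Real.cos θ)) := by
      rw [mul_comm Complex.I, Complex.inv_re, Complex.normSq_apply]
      simp only [Complex.sub_re, Complex.one_re, Complex.re_ofReal_mul,
        Complex.exp_ofReal_mul_I_re, Complex.sub_im, Complex.one_im, Complex.im_ofReal_mul,
        Complex.exp_ofReal_mul_I_im]
      congr 1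
      linear_combination q ^ 2 * Real.sin_sq_add_cos_sq θ
    rw [hinv]
    have : 1 - q ≠ 0 := by linarith
    have hden' := hden.ne'
    simp only [Finset.range_one, Finset.sum_singleton, pow_zero, Complex.one_re]
    rw [sub_self, sub_zero, inv_eq_one_div, div_sub_div _ _ hden' this,
      div_eq_div_iff (mul_ne_zero this hden') (mul_ne_zero hden' this)]
    ring

theorem geometric_minor_arc_le {s θ : ℝ} (hs : 0 < s) (hs2 : s ≤ 1 / 2) (hθ : |θ| ≤ Real.pi) :
    -(Real.exp (-s) * (1 + Real.exp (-s)) * (1 - Real.cos θ)) /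
        ((1 - Real.exp (-s)) * ((1 - Real.exp (-s)) ^ 2 +
          2 * Real.exp (-s) * (1 - Real.cos θ)))
      ≤ -(θ ^ 2 / (s * (10 * s ^ 2 + 4 * θ ^ 2))) := by
  set q := Real.exp (-s) with hq
  set x := 1 - Real.cos θ with hx
  have hq1 : q < 1 := Real.exp_lt_one_iff.2 (by linarith)
  have hqs : 1 - s ≤ q := by
    have := Real.add_one_le_exp (-s)
    linarith
  have hx5 : θ ^ 2 / 5 ≤ x := by
    have h := Real.cos_le_one_sub_mul_cos_sq hθ
    have hpi : Real.pi ^ 2 < 10 := by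
      nlinarith [Real.pi_lt_d2, Real.pi_pos]
    have : 1 / 5 ≤ 2 / Real.pi ^ 2 := by
      rw [div_le_div_iff₀ (by norm_num) (by positivity)]
      linarith
    nlinarith [sq_nonneg θ]
  have hx0 : 0 ≤ x := le_trans (by positivity) hx5
  have hq0 : 0 < 1 - q := by linarith
  rw [neg_div, neg_le_neg_iff, div_le_div_iff₀ (by positivity) (by positivity)]
  have h1 : (1 - q) * ((1 - q) ^ 2 + 2 * q * x) ≤ s * (s ^ 2 + 2 * x) := by
    have : 1 - q ≤ s := by linarith
    have : q * x ≤ x := mul_le_of_le_one_left hx0 hq1.le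
    have : 2 * q * x ≤ 2 * x := by linarith
    gcongr
  have h2 : 3 / 4 ≤ q * (1 + q) := by nlinarith
  have h3 : θ ^ 2 * (s ^ 2 + 2 * x) ≤ x * (5 * s ^ 2 + 2 * θ ^ 2) := by
    nlinarith [sq_nonneg s]
  calc _ ≤ θ ^ 2 * (s * (s ^ 2 + 2 * x)) := by gcongr
    _ = s * (θ ^ 2 * (s ^ 2 + 2 * x)) := by ring
    _ ≤ s * (x * (5 * s ^ 2 + 2 * θ ^ 2)) := by gcongr
    _ = (1 / 2) * (x * (s * (10 * s ^ 2 + 4 * θ ^ 2))) := by ring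
    _ ≤ (q * (1 + q)) * (x * (s * (10 * s ^ 2 + 4 * θ ^ 2))) := by
      gcongr
      linarith
    _ = _ := by ring

theorem exp_neg_le_inv_one_add_sq {u r : ℝ} (h : |u| * r ^ 3 ≤ 4) (hr : 0 < r) :
    Real.exp (-(u ^ 2 / (10 + 4 * u ^ 2 * r ^ 2))) ≤ 100000 * (1 + u ^ 2)⁻¹ := by
  rw [← div_eq_mul_inv]
  have hden : 0 < 10 + 4 * u ^ 2 * r ^ 2 := by positivity
  have hle1 : Real.exp (-(u ^ 2 / (10 + 4 * u ^ 2 * r ^ 2))) ≤ 1 :=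
    Real.exp_le_one_iff.2 (neg_nonpos.2 (by positivity))
  by_cases hu : u ^ 2 ≤ 1
  · refine hle1.trans ?_
    rw [le_div_iff₀ (by positivity)]
    linarith
  · push Not at hu
    have hv : (u ^ 2 * r ^ 2) ^ 3 ≤ 16 * (u ^ 2) ^ 2 := by
      have h2 : (|u| * r ^ 3) ^ 2 ≤ 4 ^ 2 := by gcongr
      rw [mul_pow, sq_abs] at h2
      have : 0 ≤ (u ^ 2) ^ 2 := by positivity
      nlinarith
    have hcube : (10 + 4 * u ^ 2 * r ^ 2) ^ 3 ≤ 4000 + 4096 * (u ^ 2) ^ 2 := by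
      have hv0 : 0 ≤ u ^ 2 * r ^ 2 := by positivity
      rw [show 10 + 4 * u ^ 2 * r ^ 2 = 10 + 4 * (u ^ 2 * r ^ 2) by ring]
      generalize u ^ 2 * r ^ 2 = v at hv hv0
      nlinarith [mul_nonneg (add_nonneg (by norm_num : (0 : ℝ) ≤ 10) (mul_nonneg zero_le_four hv0))
        (sq_nonneg (10 - 4 * v))]
    have hcube2 : (10 + 4 * u ^ 2 * r ^ 2) ^ 3 ≤ 8096 * (u ^ 2) ^ 2 := by nlinarith
    have hexp := Real.pow_div_factorial_le_exp (u ^ 2 / (10 + 4 * u ^ 2 * r ^ 2)) (by positivity) 3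
    rw [Real.exp_neg, inv_le_comm₀ (Real.exp_pos _) (by positivity)]
    refine le_trans ?_ hexp
    rw [inv_div, div_pow, div_div, div_le_div_iff₀ (by norm_num) (by positivity)]
    simp only [Nat.factorial]
    push_cast
    have hu0 : 0 < u ^ 2 := by linarith
    nlinarith [pow_pos hu0 2, pow_pos hu0 3]

end MinorArc

section SaddlePoint

variable {ι : Type*} {w : ι → ℝ} {e : ι → ℕ} {c : ℕ → ℝ} {A κ : ℝ}

theorem re_expSum_sub_le (hw : ∀ i, 0 ≤ w i)
    (hsum : ∀ s : ℝ, 0 < s → Summable fun i => w i * Real.exp (-(e i * s)))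
    {j : ℕ → ι} (hj : Function.Injective j) (hje : ∀ n, e (j n) = n + 1) (hjw : ∀ n, 1 ≤ w (j n))
    {s θ : ℝ} (hs : 0 < s) (hs2 : s ≤ 1 / 2) (hθ : |θ| ≤ Real.pi) :
    (expSum w e (s - Complex.I * θ)).re - expMoment w e 0 s
      ≤ -(θ ^ 2 / (s * (10 * s ^ 2 + 4 * θ ^ 2))) := by
  have h1 := Complex.hasSum_re (summable_expSum hw hsum (z := s - Complex.I * θ) (by simpa)).hasSum
  have h2 := (summable_expMoment hw hsum 0 hs).hasSum
  have hterm : ∀ i, ((w i : ℂ) * Complex.exp (-(e i * (s - Complex.I * θ)))).re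
      - w i * (e i : ℝ) ^ 0 * Real.exp (-(e i * s))
      = -(w i * (Real.exp (-(e i * s)) * (1 - Real.cos (e i * θ)))) := by
    intro i
    rw [show -((e i : ℂ) * (s - Complex.I * θ))
      = ((-(e i * s) : ℝ) : ℂ) + ((e i * θ : ℝ) : ℂ) * Complex.I by push_cast; ring,
      Complex.exp_add, ← Complex.ofReal_exp, Complex.re_ofReal_mul, Complex.re_ofReal_mul,
      Complex.exp_ofReal_mul_I_re]
    ring
  have h3 := h1.sub h2
  simp only [hterm] at h3
  have h4 := (hasSum_geometric_mul_cos_sub_one hs θ).neg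
  have hle := h4.summable.tsum_le_tsum_of_inj j hj (fun i _ => ?_) (fun n => ?_) h3.neg.summable
  · rw [h4.tsum_eq, h3.neg.tsum_eq] at hle
    have := geometric_minor_arc_le hs hs2 hθ
    rw [expSum, expMoment]
    linarith
  · have := hw i
    have := Real.cos_le_one (e i * θ)
    have : 0 ≤ 1 - Real.cos (e i * θ) := by linarith
    simp only [neg_neg]
    positivity
  · simp only [hje, neg_neg]
    have := Real.cos_le_one ((n + 1 : ℕ) * θ)
    rw [← mul_neg, neg_sub]
    exact le_mul_of_one_le_left (mul_nonneg (Real.exp_pos _).le (by linarith)) (hjw n)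

/-- The rescaled integrand of the saddle point integral for the `n`-th coefficient, at
`s = r²`, `θ = u r³` and `n = A / r⁴`. -/
noncomputable def saddleIntegrand (w : ι → ℝ) (e : ι → ℕ) (A r u : ℝ) : ℂ :=
  Complex.exp (expSum w e ((r ^ 2 : ℝ) - Complex.I * ((u * r ^ 3 : ℝ)))
    - expSum w e (r ^ 2 : ℝ) - Complex.I * (u * A / r))

theorem tendsto_saddleIntegrand (hw : ∀ i, 0 ≤ w i)
    (hsum : ∀ s : ℝ, 0 < s → Summable fun i => w i * Real.exp (-(e i * s)))
    (hL : Tendsto (fun s => expMoment w e 0 s - A / s - Real.log s / 2) (𝓝[>] 0) (𝓝 κ)) (u : ℝ) :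
    Tendsto (fun r => saddleIntegrand w e A r u) (𝓝[>] 0) (𝓝 (Real.exp (-A * u ^ 2) : ℝ)) := by
  obtain ⟨h1, h2⟩ := tendsto_expMoment_one_two hw hsum hL
  have h0 := tendsto_expSum_taylor hw hsum hL (u * Complex.I)
  have h1' := ((Complex.continuous_ofReal.tendsto _).comp h1).const_mul (u * Complex.I)
  have h2' := ((Complex.continuous_ofReal.tendsto _).comp h2).const_mul (-(u : ℂ) ^ 2 / 2)
  have h := (Complex.continuous_exp.tendsto _).comp ((h0.add h1').add h2')
  have hlim : Complex.exp (0 + u * Complex.I * ((0 : ℝ) : ℂ) + -(u : ℂ) ^ 2 / 2 * ((2 * A : ℝ) : ℂ))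
      = (Real.exp (-A * u ^ 2) : ℝ) := by
    rw [Complex.ofReal_exp]
    push_cast
    ring_nf
  rw [hlim] at h
  refine h.congr fun r => ?_
  simp only [Function.comp_apply, saddleIntegrand]
  congr 1
  push_cast
  have hI : Complex.I ^ 2 = -1 := Complex.I_sq
  rw [show (r : ℂ) ^ 2 - u * Complex.I * r ^ 3 = r ^ 2 - Complex.I * (u * r ^ 3) by ring]
  linear_combination (-(u : ℂ) ^ 2 * r ^ 6 / 2 * expMoment w e 2 (r ^ 2)) * hI

theorem norm_saddleIntegrand_le (hw : ∀ i, 0 ≤ w i)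
    (hsum : ∀ s : ℝ, 0 < s → Summable fun i => w i * Real.exp (-(e i * s)))
    {j : ℕ → ι} (hj : Function.Injective j) (hje : ∀ n, e (j n) = n + 1) (hjw : ∀ n, 1 ≤ w (j n))
    {r u : ℝ} (hr : 0 < r) (hr2 : r ^ 2 ≤ 1 / 2) (hu : |u * r ^ 3| ≤ Real.pi) :
    ‖saddleIntegrand w e A r u‖ ≤ 100000 * (1 + u ^ 2)⁻¹ := by
  have h := re_expSum_sub_le hw hsum hj hje hjw (s := r ^ 2) (by positivity) hr2 hu
  rw [saddleIntegrand, Complex.norm_exp]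
  have h1 : (expSum w e ((r ^ 2 : ℝ) - Complex.I * ((u * r ^ 3 : ℝ)))
      - expSum w e (r ^ 2 : ℝ) - Complex.I * (u * A / r)).re
      ≤ -(u ^ 2 / (10 + 4 * u ^ 2 * r ^ 2)) := by
    rw [expSum_ofReal, show Complex.I * ((u : ℂ) * A / r) = Complex.I * ((u * A / r : ℝ) : ℂ) by
      push_cast; rfl, Complex.sub_re, Complex.sub_re, Complex.ofReal_re, Complex.re_mul_ofReal,
      Complex.I_re, zero_mul, sub_zero]
    refine h.trans (le_of_eq ?_)
    congr 1
    field_simp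
  refine (Real.exp_le_exp.2 h1).trans (exp_neg_le_inv_one_add_sq ?_ hr)
  rw [abs_mul, abs_of_pos (pow_pos hr 3)] at hu
  linarith [Real.pi_le_four]

theorem continuous_saddleIntegrand (hw : ∀ i, 0 ≤ w i)
    (hsum : ∀ s : ℝ, 0 < s → Summable fun i => w i * Real.exp (-(e i * s))) {r : ℝ} (hr : 0 < r) :
    Continuous (saddleIntegrand w e A r) := by
  have h : Continuous fun u : ℝ => expSum w e ((r ^ 2 : ℝ) - Complex.I * ((u * r ^ 3 : ℝ))) :=
    (differentiableOn_expSum hw hsum).continuousOn.comp_continuous (by fun_prop) fun u => by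
      rw [Set.mem_ofPred_eq, Complex.sub_re, Complex.ofReal_re, Complex.re_mul_ofReal, Complex.I_re,
        zero_mul, sub_zero]
      exact pow_pos hr 2
  unfold saddleIntegrand
  fun_prop

theorem tendsto_integral_saddleIntegrand (hw : ∀ i, 0 ≤ w i)
    (hsum : ∀ s : ℝ, 0 < s → Summable fun i => w i * Real.exp (-(e i * s)))
    (hL : Tendsto (fun s => expMoment w e 0 s - A / s - Real.log s / 2) (𝓝[>] 0) (𝓝 κ))
    {j : ℕ → ι} (hj : Function.Injective j) (hje : ∀ n, e (j n) = n + 1)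
    (hjw : ∀ n, 1 ≤ w (j n)) :
    Tendsto (fun r => ∫ u in -Real.pi / r ^ 3..Real.pi / r ^ 3, saddleIntegrand w e A r u) (𝓝[>] 0)
      (𝓝 (√(Real.pi / A) : ℝ)) := by
  rw [← integral_gaussian, ← integral_complex_ofReal]
  have hkey := MeasureTheory.tendsto_integral_filter_of_dominated_convergence
    (μ := MeasureTheory.volume) (l := 𝓝[>] (0 : ℝ))
    (F := fun r => (Set.Ioc (-Real.pi / r ^ 3) (Real.pi / r ^ 3)).indicator
      (saddleIntegrand w e A r))
    (f := fun u => ((Real.exp (-A * u ^ 2) : ℝ) : ℂ)) (fun u => 100000 * (1 + u ^ 2)⁻¹) ?_ ?_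
    (integrable_inv_one_add_sq.const_mul _) ?_
  · refine hkey.congr' ?_
    filter_upwards [self_mem_nhdsWithin] with r hr
    have hr : 0 < r := hr
    have : -Real.pi / r ^ 3 ≤ Real.pi / r ^ 3 := by
      have := Real.pi_pos
      gcongr
      linarith
    rw [MeasureTheory.integral_indicator measurableSet_Ioc, intervalIntegral.integral_of_le this]
  · filter_upwards [self_mem_nhdsWithin] with r hr
    exact (continuous_saddleIntegrand hw hsum hr).aestronglyMeasurable.indicator measurableSet_Ioc
  · have hr1 : ∀ᶠ r : ℝ in 𝓝[>] 0, r ∈ Set.Ioo (0 : ℝ) (1 / 2) := Ioo_mem_nhdsGT (by norm_num)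
    filter_upwards [hr1] with r hr
    refine Eventually.of_forall fun u => ?_
    rw [Set.indicator_apply]
    split_ifs with hu
    · have h3 := pow_pos hr.1 3
      refine norm_saddleIntegrand_le hw hsum hj hje hjw hr.1 (by nlinarith [hr.1, hr.2]) ?_
      rw [abs_le]
      constructor
      · have := (div_lt_iff₀ h3).1 hu.1
        linarith
      · exact (le_div_iff₀ h3).1 hu.2
    · rw [norm_zero]
      positivity
  · refine Eventually.of_forall fun u => ?_
    refine (tendsto_saddleIntegrand hw hsum hL u).congr' ?_
    have hid : Tendsto (fun s : ℝ => s) (𝓝[>] 0) (𝓝 0) := tendsto_id.mono_left nhdsWithin_le_nhds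
    have hsmall : Tendsto (fun r : ℝ => |u| * r ^ 3) (𝓝[>] 0) (𝓝 0) := by
      simpa using (hid.pow 3).const_mul |u|
    filter_upwards [self_mem_nhdsWithin, hsmall.eventually_lt_const Real.pi_pos] with r hr hu
    have hr3 : 0 < r ^ 3 := pow_pos (show 0 < r from hr) 3
    rw [Set.indicator_of_mem]
    constructor
    · rw [div_lt_iff₀ hr3]
      nlinarith [neg_abs_le u]
    · rw [le_div_iff₀ hr3]
      nlinarith [le_abs_self u]

theorem integral_saddleIntegrand_eq (hw : ∀ i, 0 ≤ w i)
    (hsum : ∀ s : ℝ, 0 < s → Summable fun i => w i * Real.exp (-(e i * s)))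
    (hc : ∀ n, 0 ≤ c n)
    (hgf : ∀ s : ℝ, 0 < s →
      HasSum (fun n => c n * Real.exp (-(n * s))) (Real.exp (expMoment w e 0 s)))
    {n : ℕ} {r : ℝ} (hr : 0 < r) (hn : n * r ^ 4 = A) :
    ∫ u in -Real.pi / r ^ 3..Real.pi / r ^ 3, saddleIntegrand w e A r u
      = (2 * Real.pi * c n * Real.exp (-(A / r ^ 2)) * Real.exp (-expMoment w e 0 (r ^ 2)) / r ^ 3
        : ℝ) := by
  have hr3 : r ^ 3 ≠ 0 := (pow_pos hr 3).ne'
  have hnr : A / r ^ 2 = n * r ^ 2 := by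
    rw [← hn]
    field_simp
  have hrw : ∀ u : ℝ, saddleIntegrand w e A r u
      = (fun θ : ℝ => expSum c (fun n => n) ((r ^ 2 : ℝ) - Complex.I * θ)
        * Complex.exp (-(n * (Complex.I * θ))) * Complex.exp (-expSum w e (r ^ 2 : ℝ)))
          (u * r ^ 3) := by
    intro u
    have hre : 0 < (((r ^ 2 : ℝ) : ℂ) - Complex.I * ((u * r ^ 3 : ℝ))).re := by
      rw [Complex.sub_re, Complex.ofReal_re, Complex.re_mul_ofReal, Complex.I_re,
        zero_mul, sub_zero]
      exact pow_pos hr 2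
    simp only [saddleIntegrand]
    rw [expSum_eq_exp_expSum hw hsum hc hgf hre, ← Complex.exp_add, ← Complex.exp_add]
    congr 1
    have : (u : ℂ) * A / r = n * (u * r ^ 3) := by
      rw [← hn]
      have : (r : ℂ) ≠ 0 := Complex.ofReal_ne_zero.2 hr.ne'
      push_cast
      field_simp
    rw [this]
    push_cast
    ring
  simp_rw [hrw]
  rw [intervalIntegral.integral_comp_mul_right
    (fun θ : ℝ => expSum c (fun n => n) ((r ^ 2 : ℝ) - Complex.I * θ)
        * Complex.exp (-(n * (Complex.I * θ))) * Complex.exp (-expSum w e (r ^ 2 : ℝ))) hr3,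
    div_mul_cancel₀ _ hr3, div_mul_cancel₀ _ hr3, intervalIntegral.integral_mul_const,
    integral_expSum_mul_exp hc (fun s hs => (hgf s hs).summable) n (pow_pos hr 2), hnr,
    expSum_ofReal, Complex.real_smul]
  push_cast
  ring

/-- Asymptotics of the coefficients of `exp (∑ w_i z ^ e_i)`, when the logarithm grows like
`A / s + log s / 2 + κ` at `z = exp (-s)`. -/
theorem tendsto_coeff_of_tendsto_expMoment (hA : 0 < A) (hw : ∀ i, 0 ≤ w i)
    (hsum : ∀ s : ℝ, 0 < s → Summable fun i => w i * Real.exp (-(e i * s)))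
    (hL : Tendsto (fun s => expMoment w e 0 s - A / s - Real.log s / 2) (𝓝[>] 0) (𝓝 κ))
    {j : ℕ → ι} (hj : Function.Injective j) (hje : ∀ n, e (j n) = n + 1)
    (hjw : ∀ n, 1 ≤ w (j n)) (hc : ∀ n, 0 ≤ c n)
    (hgf : ∀ s : ℝ, 0 < s →
      HasSum (fun n => c n * Real.exp (-(n * s))) (Real.exp (expMoment w e 0 s))) :
    Tendsto (fun n : ℕ => c n * n * Real.exp (-(2 * √(A * n)))) atTop
      (𝓝 (√(Real.pi / A) * (A / (2 * Real.pi) * Real.exp κ))) := by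
  have hr : Tendsto (fun n : ℕ => √√(A / n)) atTop (𝓝[>] 0) := by
    refine tendsto_nhdsWithin_iff.2 ⟨?_, ?_⟩
    · have := ((tendsto_const_div_atTop_nhds_zero_nat A).sqrt).sqrt
      simpa using this
    · filter_upwards [eventually_gt_atTop 0] with n hn
      have : (0 : ℝ) < n := Nat.cast_pos.2 hn
      exact (by positivity : 0 < √√(A / n))
  have h1 := (Complex.continuous_re.tendsto _).comp
    ((tendsto_integral_saddleIntegrand hw hsum hL hj hje hjw).comp hr)
  have h2 := ((Real.continuous_exp.tendsto _).comp
    ((hL.comp tendsto_sq_nhdsGT_zero).comp hr)).const_mul (A / (2 * Real.pi))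
  have h := h1.mul h2
  rw [Complex.ofReal_re] at h
  refine h.congr' ?_
  filter_upwards [eventually_gt_atTop 0] with n hn
  have hn : (0 : ℝ) < n := Nat.cast_pos.2 hn
  simp only [Function.comp_apply]
  set r := √√(A / n) with hrdef
  have hr0 : 0 < r := by positivity
  have hr2 : r ^ 2 = √(A / n) := Real.sq_sqrt (Real.sqrt_nonneg _)
  have hr4 : n * r ^ 4 = A := by
    rw [show r ^ 4 = (r ^ 2) ^ 2 by ring, hr2, Real.sq_sqrt (by positivity)]
    field_simp
  have hsq : √(A * n) = A / r ^ 2 := by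
    rw [Real.sqrt_eq_iff_eq_sq (by positivity) (by positivity), div_pow, eq_div_iff (by positivity),
      ← hr4]
    ring
  rw [integral_saddleIntegrand_eq hw hsum hc hgf hr0 hr4, Complex.ofReal_re, hsq,
    Real.log_pow, Nat.cast_ofNat, mul_div_cancel_left₀ _ (two_ne_zero' ℝ), sub_sub, add_comm,
    sub_eq_add_neg _ (Real.log r + _), neg_add, Real.exp_add, Real.exp_add, Real.exp_neg (Real.log r),
    Real.exp_log hr0, show -(2 * (A / r ^ 2)) = -(A / r ^ 2) + -(A / r ^ 2) by ring, Real.exp_add]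
  have hE : Real.exp (-expMoment w e 0 (r ^ 2)) * Real.exp (expMoment w e 0 (r ^ 2)) = 1 := by
    rw [← Real.exp_add]
    simp
  generalize Real.exp (-expMoment w e 0 (r ^ 2)) = E1 at hE ⊢
  generalize Real.exp (expMoment w e 0 (r ^ 2)) = E2 at hE ⊢
  generalize Real.exp (-(A / r ^ 2)) = E3
  have hpi := Real.pi_pos
  have hA' : A / r ^ 4 = n := by
    rw [← hr4]
    field_simp
  rw [← hA']
  calc _ = (E1 * E2) * (c n * E3 ^ 2 * (A / r ^ 4)) := by
        field_simp
    _ = _ := by rw [hE]; ring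

end SaddlePoint

namespace Ptn

@[ext]
theorem ext {lam mu : Ptn} (h : ∀ i, lam.part i = mu.part i) : lam = mu := by
  cases lam
  cases mu
  congr
  exact Finsupp.ext h

theorem part_antitone (lam : Ptn) : Antitone lam.part := fun _ _ h => lam.antitone' h

theorem exists_part_eq_zero (lam : Ptn) : ∃ N, ∀ i, N ≤ i → lam.part i = 0 := by
  refine ⟨lam.toFun.support.sup id + 1, fun i hi => ?_⟩
  by_contra h
  have := Finset.le_sup (f := id) (Finsupp.mem_support_iff.2 h)
  simp only [id] at this
  omega

theorem size_eq_sum_range (lam : Ptn) {N : ℕ} (h : ∀ i, N ≤ i → lam.part i = 0) :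
    lam.size = ∑ i ∈ Finset.range N, lam.part i := by
  refine Finsupp.sum_of_support_subset _ (fun i hi => ?_) _ fun _ _ => rfl
  rw [Finset.mem_range]
  by_contra hN
  exact Finsupp.mem_support_iff.1 hi (h i (not_lt.1 hN))

/-- The partition with prescribed parts. -/
noncomputable def ofParts (f : ℕ → ℕ) (hf : Antitone f) (h0 : ∃ N, ∀ i, N ≤ i → f i = 0) : Ptn where
  toFun := Finsupp.ofSupportFinite f (by
    obtain ⟨N, hN⟩ := h0
    refine (Set.finite_Iio N).subset fun i hi => ?_
    by_contra h
    exact hi (hN i (not_lt.1 h)))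
  antitone' := hf

@[simp]
theorem part_ofParts (f : ℕ → ℕ) (hf : Antitone f) (h0 : ∃ N, ∀ i, N ≤ i → f i = 0) (i : ℕ) :
    (ofParts f hf h0).part i = f i := rfl

/-- For fixed `μ, ν`, the partitions `λ` with `μ ≺ λ ≻ ν` correspond to pairs consisting of a
partition `ρ` with `μ ≻ ρ ≺ ν` and a natural number. -/
noncomputable def hstripEquiv (mu nu : Ptn) :
    {lam : Ptn // HStrip mu lam ∧ HStrip nu lam} ≃ {rho : Ptn // HStrip rho mu ∧ HStrip rho nu} × ℕ where
  toFun lam := (⟨ofParts (fun i => max (mu.part (i + 1)) (nu.part (i + 1))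
      + min (mu.part i) (nu.part i) - lam.1.part (i + 1)) (by
        obtain ⟨lam, h1, h2⟩ := lam
        refine antitone_nat_of_succ_le fun i => ?_
        have a1 := h1 (i + 1)
        have a2 := h2 (i + 1)
        have a3 := h1 i
        have a4 := h2 i
        have a5 := h1 (i + 1 + 1)
        have a6 := h2 (i + 1 + 1)
        dsimp only
        omega) (by
        obtain ⟨N, hN⟩ := mu.exists_part_eq_zero
        obtain ⟨M, hM⟩ := nu.exists_part_eq_zero
        refine ⟨max N M, fun i hi => ?_⟩
        have := hN i (by omega)
        have := hN (i + 1) (by omega)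
        have := hM i (by omega)
        have := hM (i + 1) (by omega)
        omega), by
        obtain ⟨lam, h1, h2⟩ := lam
        constructor <;> intro i <;> rw [part_ofParts]
        all_goals
          have a1 := h1 (i + 1)
          have a2 := h2 (i + 1)
          have a3 := h1 i
          have a4 := h2 i
          dsimp only
          omega⟩, lam.1.part 0 - max (mu.part 0) (nu.part 0))
  invFun p := ⟨ofParts (fun i => match i with
      | 0 => max (mu.part 0) (nu.part 0) + p.2
      | i + 1 => max (mu.part (i + 1)) (nu.part (i + 1))
        + min (mu.part i) (nu.part i) - p.1.1.part i) (by
        obtain ⟨⟨rho, h1, h2⟩, k⟩ := p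
        refine antitone_nat_of_succ_le fun i => ?_
        have a1 := h1 i
        have a2 := h2 i
        cases i with
        | zero => dsimp only; omega
        | succ i =>
          have a3 := h1 (i + 1)
          have a4 := h2 (i + 1)
          have a5 := h1 i
          have a6 := h2 i
          dsimp only
          omega) (by
        obtain ⟨N, hN⟩ := mu.exists_part_eq_zero
        obtain ⟨M, hM⟩ := nu.exists_part_eq_zero
        refine ⟨max N M + 1, fun i hi => ?_⟩
        cases i with
        | zero => omega
        | succ i =>
          have := hN i (by omega)
          have := hN (i + 1) (by omega)
          have := hM i (by omega)
          have := hM (i + 1) (by omega)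
          dsimp only
          omega), by
        obtain ⟨⟨rho, h1, h2⟩, k⟩ := p
        constructor <;> intro i <;> rw [part_ofParts, part_ofParts]
        all_goals
          have a1 := h1 i
          have a2 := h2 i
          cases i with
          | zero => dsimp only; omega
          | succ i =>
            have a3 := h1 i
            have a4 := h2 i
            dsimp only
            omega⟩
  left_inv := by
    rintro ⟨lam, h1, h2⟩
    refine Subtype.ext (ext fun i => ?_)
    dsimp only
    rw [part_ofParts]
    cases i with
    | zero =>
      have a1 := h1 0
      have a2 := h2 0
      dsimp only
      omega
    | succ i =>
      have a1 := h1 (i + 1)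
      have a2 := h2 (i + 1)
      have a3 := h1 i
      have a4 := h2 i
      dsimp only [part_ofParts]
      omega
  right_inv := by
    rintro ⟨⟨rho, h1, h2⟩, k⟩
    refine Prod.ext (Subtype.ext (ext fun i => ?_)) ?_
    · have a1 := h1 i
      have a2 := h2 i
      simp only [part_ofParts]
      omega
    · simp only [part_ofParts]
      omega

theorem size_add_size_hstripEquiv (mu nu : Ptn) (lam : {lam : Ptn // HStrip mu lam ∧ HStrip nu lam}) :
    lam.1.size + (hstripEquiv mu nu lam).1.1.size
      = mu.size + nu.size + (hstripEquiv mu nu lam).2 := by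
  obtain ⟨lam, h1, h2⟩ := lam
  obtain ⟨N, hN⟩ := mu.exists_part_eq_zero
  obtain ⟨M, hM⟩ := nu.exists_part_eq_zero
  have hlam : ∀ i, max N M + 1 ≤ i → lam.part i = 0 := fun i hi => by
    have a1 := h1 (i - 1)
    have a2 := hN (i - 1) (by omega)
    rw [show i - 1 + 1 = i by omega] at a1
    omega
  have hrho : ∀ i, max N M ≤ i → (hstripEquiv mu nu ⟨lam, h1, h2⟩).1.1.part i = 0 := fun i hi => by
    have a1 := (hstripEquiv mu nu ⟨lam, h1, h2⟩).1.2.1 i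
    have a2 := hN i (by omega)
    omega
  have hmu : ∀ i, max N M + 1 ≤ i → mu.part i = 0 := fun i hi => hN i (by omega)
  have hmu' : ∀ i, max N M ≤ i → mu.part i = 0 := fun i hi => hN i (by omega)
  have hnu : ∀ i, max N M ≤ i → nu.part i = 0 := fun i hi => hM i (by omega)
  have hnu' : ∀ i, max N M + 1 ≤ i → nu.part i = 0 := fun i hi => hM i (by omega)
  have e1 := mu.size_eq_sum_range hmu'
  have e2 := mu.size_eq_sum_range hmu
  have e3 := nu.size_eq_sum_range hnu
  have e4 := nu.size_eq_sum_range hnu'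
  rw [Finset.sum_range_succ'] at e2 e4
  have e5 : ∑ i ∈ Finset.range (max N M), lam.part (i + 1)
      + ∑ i ∈ Finset.range (max N M), (hstripEquiv mu nu ⟨lam, h1, h2⟩).1.1.part i
      = ∑ i ∈ Finset.range (max N M), max (mu.part (i + 1)) (nu.part (i + 1))
      + ∑ i ∈ Finset.range (max N M), min (mu.part i) (nu.part i) := by
    rw [← Finset.sum_add_distrib, ← Finset.sum_add_distrib]
    refine Finset.sum_congr rfl fun i _ => ?_
    have a1 := h1 (i + 1)
    have a2 := h2 (i + 1)
    have a3 := h1 i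
    have a4 := h2 i
    simp only [hstripEquiv, Equiv.coe_fn_mk, part_ofParts]
    omega
  have e6 : ∑ i ∈ Finset.range (max N M), max (mu.part (i + 1)) (nu.part (i + 1))
      + ∑ i ∈ Finset.range (max N M), min (mu.part (i + 1)) (nu.part (i + 1))
      = ∑ i ∈ Finset.range (max N M), mu.part (i + 1)
      + ∑ i ∈ Finset.range (max N M), nu.part (i + 1) := by
    rw [← Finset.sum_add_distrib, ← Finset.sum_add_distrib]
    exact Finset.sum_congr rfl fun i _ => max_add_min _ _
  have e7 : ∑ i ∈ Finset.range (max N M), min (mu.part i) (nu.part i)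
      = ∑ i ∈ Finset.range (max N M), min (mu.part (i + 1)) (nu.part (i + 1))
        + min (mu.part 0) (nu.part 0) := by
    rw [← Finset.sum_range_succ' (fun i => min (mu.part i) (nu.part i)), Finset.sum_range_succ,
      hmu' _ le_rfl, zero_min, add_zero]
  have e8 : (hstripEquiv mu nu ⟨lam, h1, h2⟩).2 = lam.part 0 - max (mu.part 0) (nu.part 0) := rfl
  have a1 := h1 0
  have a2 := h2 0
  rw [lam.size_eq_sum_range hlam, size_eq_sum_range _ hrho, Finset.sum_range_succ', e8]
  omega

end Ptn

theorem HStrip.size_le {mu lam : Ptn} (h : HStrip mu lam) : mu.size ≤ lam.size := by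
  obtain ⟨N, hN⟩ := lam.exists_part_eq_zero
  rw [lam.size_eq_sum_range hN, mu.size_eq_sum_range (N := N) fun i hi => by
    have := (h i).1
    have := hN i hi
    omega]
  exact Finset.sum_le_sum fun i _ => (h i).1

theorem HStrip.eq_of_size_le {mu lam : Ptn} (h : HStrip mu lam) (hs : lam.size ≤ mu.size) :
    lam = mu := by
  obtain ⟨N, hN⟩ := lam.exists_part_eq_zero
  have hN' : ∀ i, N ≤ i → mu.part i = 0 := fun i hi => by
    have := (h i).1
    have := hN i hi
    omega
  have hsize := le_antisymm hs h.size_le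
  rw [lam.size_eq_sum_range hN, mu.size_eq_sum_range hN', eq_comm,
    Finset.sum_eq_sum_iff_of_le fun i _ => (h i).1] at hsize
  refine Ptn.ext fun i => ?_
  by_cases hi : i < N
  · exact (hsize i (Finset.mem_range.2 hi)).symm
  · rw [hN i (not_lt.1 hi), hN' i (not_lt.1 hi)]

theorem HStrip.refl (lam : Ptn) : HStrip lam lam :=
  fun i => ⟨le_rfl, lam.part_antitone (Nat.le_succ i)⟩

section Operators

open scoped ENNReal

open Classical in
/-- The weight `x ^ (|λ| - |μ|)` of the horizontal strip `λ / μ`, zero if `λ / μ` is not one. -/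
noncomputable def stripWeight (x : ℝ≥0∞) (mu lam : Ptn) : ℝ≥0∞ :=
  if HStrip mu lam then x ^ (lam.size - mu.size) else 0

/-- Sum of `f` over the ways of adding a horizontal strip. -/
noncomputable def stripUp (x : ℝ≥0∞) (f : Ptn → ℝ≥0∞) (mu : Ptn) : ℝ≥0∞ :=
  ∑' lam, stripWeight x mu lam * f lam

/-- Sum of `f` over the ways of removing a horizontal strip. -/
noncomputable def stripDown (x : ℝ≥0∞) (f : Ptn → ℝ≥0∞) (lam : Ptn) : ℝ≥0∞ :=
  ∑' mu, stripWeight x mu lam * f mu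

theorem stripWeight_self (x : ℝ≥0∞) (lam : Ptn) : stripWeight x lam lam = 1 := by
  simp [stripWeight, HStrip.refl]

theorem pow_mul_stripWeight (t x : ℝ≥0∞) (mu lam : Ptn) :
    t ^ lam.size * stripWeight x mu lam = t ^ mu.size * stripWeight (t * x) mu lam := by
  unfold stripWeight
  split_ifs with h
  · obtain ⟨d, hd⟩ := Nat.exists_eq_add_of_le h.size_le
    rw [hd, Nat.add_sub_cancel_left, mul_pow, pow_add, mul_assoc]
  · simp

theorem stripWeight_one_mul (x : ℝ≥0∞) (mu lam : Ptn) :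
    stripWeight 1 mu lam * stripWeight x mu lam = stripWeight x mu lam := by
  unfold stripWeight
  split_ifs <;> simp

theorem tsum_stripWeight_mul_stripWeight (x y : ℝ≥0∞) (mu nu : Ptn) :
    ∑' lam, stripWeight y mu lam * stripWeight x nu lam
      = (1 - x * y)⁻¹ * ∑' rho, stripWeight x rho mu * stripWeight y rho nu := by
  have hX : Function.support (fun lam => stripWeight y mu lam * stripWeight x nu lam)
      ⊆ {lam | HStrip mu lam ∧ HStrip nu lam} := by
    intro lam h
    by_contra hn
    refine h ?_
    rw [Set.mem_ofPred_eq, not_and_or] at hn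
    rcases hn with hn | hn <;> simp [stripWeight, hn]
  have hY : Function.support (fun rho => stripWeight x rho mu * stripWeight y rho nu)
      ⊆ {rho | HStrip rho mu ∧ HStrip rho nu} := by
    intro rho h
    by_contra hn
    refine h ?_
    rw [Set.mem_ofPred_eq, not_and_or] at hn
    rcases hn with hn | hn <;> simp [stripWeight, hn]
  rw [← tsum_subtype_eq_of_support_subset hX, ← tsum_subtype_eq_of_support_subset hY,
    ← ENNReal.tsum_geometric, mul_comm, ← ENNReal.tsum_mul_right]
  simp_rw [← ENNReal.tsum_mul_left]
  rw [← ENNReal.tsum_prod (f := fun (rho : {rho | HStrip rho mu ∧ HStrip rho nu}) (k : ℕ) =>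
    stripWeight x rho.1 mu * stripWeight y rho.1 nu * (x * y) ^ k)]
  refine Eq.trans ?_ ((Ptn.hstripEquiv mu nu).tsum_eq
    fun p => stripWeight x p.1.1 mu * stripWeight y p.1.1 nu * (x * y) ^ p.2)
  refine tsum_congr fun lam => ?_
  have hs := Ptn.size_add_size_hstripEquiv mu nu lam
  have h1 := (Ptn.hstripEquiv mu nu lam).1.2
  have e1 := lam.2.1.size_le
  have e2 := lam.2.2.size_le
  have e3 := h1.1.size_le
  have e4 := h1.2.size_le
  simp only [stripWeight]
  rw [if_pos lam.2.1, if_pos lam.2.2, if_pos h1.1, if_pos h1.2,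
    show lam.1.size - mu.size = nu.size - (Ptn.hstripEquiv mu nu lam).1.1.size
      + (Ptn.hstripEquiv mu nu lam).2 by omega,
    show lam.1.size - nu.size = mu.size - (Ptn.hstripEquiv mu nu lam).1.1.size
      + (Ptn.hstripEquiv mu nu lam).2 by omega, pow_add, pow_add, mul_pow]
  ring

theorem stripUp_const_mul (x a : ℝ≥0∞) (f : Ptn → ℝ≥0∞) :
    (stripUp x fun mu => a * f mu) = fun mu => a * stripUp x f mu := by
  ext mu
  simp only [stripUp]
  rw [← ENNReal.tsum_mul_left]
  exact tsum_congr fun _ => mul_left_comm _ _ _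

theorem stripUp_stripDown (x y : ℝ≥0∞) (f : Ptn → ℝ≥0∞) :
    stripUp y (stripDown x f) = fun mu => (1 - x * y)⁻¹ * stripDown x (stripUp y f) mu := by
  ext mu
  simp only [stripUp, stripDown]
  simp_rw [← ENNReal.tsum_mul_left, ← mul_assoc]
  rw [ENNReal.tsum_comm]
  simp_rw [ENNReal.tsum_mul_right, tsum_stripWeight_mul_stripWeight, mul_assoc,
    ENNReal.tsum_mul_left]
  congr 1
  simp_rw [← ENNReal.tsum_mul_right]
  rw [ENNReal.tsum_comm]
  simp_rw [mul_assoc, ENNReal.tsum_mul_left]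

theorem stripUp_one (x : ℝ≥0∞) :
    stripUp x 1 = fun mu => (1 - x)⁻¹ * stripDown x 1 mu := by
  ext mu
  have h := tsum_stripWeight_mul_stripWeight x 1 mu mu
  simp_rw [mul_comm (stripWeight x _ mu), stripWeight_one_mul, mul_one] at h
  simpa only [stripUp, stripDown, Pi.one_apply, mul_one] using h

/-- The partition sum of `f` weighted by `t ^ |μ|`. -/
noncomputable def sizeSum (t : ℝ≥0∞) (f : Ptn → ℝ≥0∞) : ℝ≥0∞ := ∑' mu, t ^ mu.size * f mu

theorem sizeSum_stripDown (t x : ℝ≥0∞) (f : Ptn → ℝ≥0∞) :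
    sizeSum t (stripDown x f) = (1 - t * x)⁻¹ * sizeSum t (stripUp (t * (t * x)) f) := by
  have h1 : sizeSum t (stripDown x f) = ∑' nu, t ^ nu.size * stripUp (t * x) 1 nu * f nu := by
    simp only [sizeSum, stripDown, stripUp, Pi.one_apply, mul_one]
    simp_rw [← ENNReal.tsum_mul_left, ← ENNReal.tsum_mul_right]
    rw [ENNReal.tsum_comm]
    simp_rw [← mul_assoc, pow_mul_stripWeight]
  rw [h1, stripUp_one]
  simp only [sizeSum, stripDown, stripUp, Pi.one_apply, mul_one]
  simp_rw [← ENNReal.tsum_mul_left, ← ENNReal.tsum_mul_right]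
  rw [ENNReal.tsum_comm]
  refine tsum_congr fun rho => tsum_congr fun nu => ?_
  have := pow_mul_stripWeight t (t * x) rho nu
  rw [← mul_assoc (t ^ rho.size), ← this]
  ring

/-- Iterated `stripUp`, the head of the list acting first. -/
noncomputable def stripChain (l : List ℝ≥0∞) (f : Ptn → ℝ≥0∞) : Ptn → ℝ≥0∞ :=
  l.foldl (fun g x => stripUp x g) f

@[simp]
theorem stripChain_nil (f : Ptn → ℝ≥0∞) : stripChain [] f = f := rfl

@[simp]
theorem stripChain_cons (x : ℝ≥0∞) (l : List ℝ≥0∞) (f : Ptn → ℝ≥0∞) :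
    stripChain (x :: l) f = stripChain l (stripUp x f) := rfl

theorem stripChain_concat (x : ℝ≥0∞) (l : List ℝ≥0∞) (f : Ptn → ℝ≥0∞) :
    stripChain (l ++ [x]) f = stripUp x (stripChain l f) := by
  simp [stripChain]

theorem stripChain_const_mul (l : List ℝ≥0∞) (a : ℝ≥0∞) (f : Ptn → ℝ≥0∞) :
    (stripChain l fun mu => a * f mu) = fun mu => a * stripChain l f mu := by
  induction l generalizing f with
  | nil => rfl
  | cons x l ih => rw [stripChain_cons, stripUp_const_mul, ih, stripChain_cons]

theorem stripChain_stripDown (l : List ℝ≥0∞) (x : ℝ≥0∞) (f : Ptn → ℝ≥0∞) :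
    stripChain l (stripDown x f)
      = fun mu => (l.map fun y => (1 - x * y)⁻¹).prod * stripDown x (stripChain l f) mu := by
  induction l generalizing f with
  | nil => simp
  | cons y l ih =>
    rw [stripChain_cons, stripUp_stripDown, stripChain_const_mul, ih]
    ext mu
    rw [List.map_cons, List.prod_cons, stripChain_cons, mul_assoc]

/-- Moving the first variable of a chain of horizontal strips around the boundary. -/
theorem sizeSum_stripChain_cons (t x : ℝ≥0∞) (l : List ℝ≥0∞) :
    sizeSum t (stripChain (x :: l) 1)
      = (1 - x)⁻¹ * (1 - t * x)⁻¹ * (l.map fun y => (1 - x * y)⁻¹).prod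
        * sizeSum t (stripChain (l ++ [t * (t * x)]) 1) := by
  have hconst : ∀ (a : ℝ≥0∞) (f : Ptn → ℝ≥0∞),
      (sizeSum t fun mu => a * f mu) = a * sizeSum t f := fun a f => by
    simp only [sizeSum]
    rw [← ENNReal.tsum_mul_left]
    exact tsum_congr fun _ => mul_left_comm _ _ _
  rw [stripChain_cons, stripUp_one, stripChain_const_mul, hconst, stripChain_stripDown, hconst,
    sizeSum_stripDown, stripChain_concat]
  ring

/-- The product of `(1 - x y)⁻¹ (1 - t² x y)⁻¹` over the pairs of entries of a list. -/
noncomputable def pairFactor (t : ℝ≥0∞) : List ℝ≥0∞ → ℝ≥0∞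
  | [] => 1
  | x :: l => (l.map fun y => (1 - x * y)⁻¹ * (1 - t * (t * (x * y)))⁻¹).prod * pairFactor t l

theorem sizeSum_stripChain_append (t : ℝ≥0∞) (l l' : List ℝ≥0∞) :
    sizeSum t (stripChain (l ++ l') 1)
      = (l.map fun x => (1 - x)⁻¹ * (1 - t * x)⁻¹).prod * pairFactor t l
        * (l.map fun x => (l'.map fun y => (1 - x * y)⁻¹).prod).prod
        * sizeSum t (stripChain (l' ++ l.map fun x => t * (t * x)) 1) := by
  induction l generalizing l' with
  | nil => simp [pairFactor]
  | cons x l ih =>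
    rw [List.cons_append, sizeSum_stripChain_cons, List.append_assoc, ih]
    have h1 : ∀ y, y * (t * (t * x)) = t * (t * (x * y)) := fun y => by ring
    simp only [List.map_cons, List.prod_cons, List.map_append, List.prod_append, List.map_nil,
      List.prod_nil, pairFactor, List.prod_map_mul, List.append_assoc, List.cons_append,
      List.nil_append, mul_one, h1]
    ring

theorem sizeSum_stripChain_round (t : ℝ≥0∞) (l : List ℝ≥0∞) :
    sizeSum t (stripChain l 1)
      = (l.map fun x => (1 - x)⁻¹ * (1 - t * x)⁻¹).prod * pairFactor t l
        * sizeSum t (stripChain (l.map fun x => t * (t * x)) 1) := by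
  have h := sizeSum_stripChain_append t l []
  simpa using h

theorem one_le_stripChain (l : List ℝ≥0∞) : 1 ≤ stripChain l 1 := by
  induction l using List.reverseRecOn with
  | nil => exact le_rfl
  | append_singleton l x ih =>
    intro mu
    rw [stripChain_concat]
    refine le_trans ?_ (ENNReal.le_tsum mu)
    rw [stripWeight_self, one_mul]
    exact ih mu

theorem stripWeight_mul_le {c : ℝ≥0∞} (hc : c ≤ 1) (x : ℝ≥0∞) (mu lam : Ptn) :
    stripWeight (c * x) mu lam ≤ stripWeight x mu lam := by
  unfold stripWeight
  split_ifs
  · gcongr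
    exact mul_le_of_le_one_left' hc
  · exact le_rfl

theorem stripWeight_mul_le_of_ne {c : ℝ≥0∞} (hc : c ≤ 1) (x : ℝ≥0∞) {mu lam : Ptn}
    (hne : lam ≠ mu) : stripWeight (c * x) mu lam ≤ c * stripWeight x mu lam := by
  unfold stripWeight
  split_ifs with h
  · rw [mul_pow]
    gcongr
    refine pow_le_of_le_one zero_le hc ?_
    intro h0
    exact hne (h.eq_of_size_le (by omega))
  · exact zero_le

theorem stripChain_mul_le {c : ℝ≥0∞} (hc : c ≤ 1) (l : List ℝ≥0∞) (mu : Ptn) :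
    stripChain (l.map fun x => c * x) 1 mu ≤ 1 + c * stripChain l 1 mu ∧
      stripChain (l.map fun x => c * x) 1 mu ≤ stripChain l 1 mu := by
  classical
  induction l using List.reverseRecOn generalizing mu with
  | nil => simp
  | append_singleton l x ih =>
    rw [List.map_append, List.map_singleton, stripChain_concat, stripChain_concat]
    constructor
    · have h1 : ∀ lam, stripWeight (c * x) mu lam * stripChain (l.map fun x => c * x) 1 lam
          ≤ (if lam = mu then 1 else 0) + c * (stripWeight x mu lam * stripChain l 1 lam) := by
        intro lam
        split_ifs with h
        · subst h
          rw [stripWeight_self, stripWeight_self, one_mul, one_mul]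
          exact (ih lam).1
        · rw [zero_add, ← mul_assoc]
          exact mul_le_mul' (stripWeight_mul_le_of_ne hc x h) (ih lam).2
      refine (ENNReal.tsum_le_tsum h1).trans (le_of_eq ?_)
      rw [ENNReal.tsum_add, ENNReal.tsum_mul_left, tsum_ite_eq]
      rfl
    · exact ENNReal.tsum_le_tsum fun lam => mul_le_mul' (stripWeight_mul_le hc x mu lam) (ih lam).2

theorem sizeSum_stripChain_mul_le (t : ℝ≥0∞) {c : ℝ≥0∞} (hc : c ≤ 1) (l : List ℝ≥0∞) :
    sizeSum t (stripChain (l.map fun x => c * x) 1)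
      ≤ sizeSum t 1 + c * sizeSum t (stripChain l 1) := by
  simp only [sizeSum]
  rw [← ENNReal.tsum_mul_left, ← ENNReal.tsum_add]
  refine ENNReal.tsum_le_tsum fun mu => ?_
  calc _ ≤ t ^ mu.size * (1 + c * stripChain l 1 mu) := by
        gcongr
        exact (stripChain_mul_le hc l mu).1
    _ = _ := by
        rw [Pi.one_apply]
        ring

theorem tendsto_sizeSum_stripChain_mul {t : ℝ≥0∞} {l : List ℝ≥0∞}
    (hfin : sizeSum t (stripChain l 1) ≠ ∞) {c : ℕ → ℝ≥0∞} (hc1 : ∀ n, c n ≤ 1)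
    (hc : Tendsto c atTop (𝓝 0)) :
    Tendsto (fun n => sizeSum t (stripChain (l.map fun x => c n * x) 1)) atTop
      (𝓝 (sizeSum t 1)) := by
  refine tendsto_of_tendsto_of_tendsto_of_le_of_le (tendsto_const_nhds (x := sizeSum t 1))
    (h := fun n => sizeSum t 1 + c n * sizeSum t (stripChain l 1)) ?_ (fun n => ?_)
    fun n => sizeSum_stripChain_mul_le t (hc1 n) l
  · have := (ENNReal.Tendsto.mul_const hc (Or.inr hfin)).const_add (sizeSum t 1)
    simpa using this
  · exact ENNReal.tsum_le_tsum fun mu => by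
      gcongr
      exact one_le_stripChain _ mu

end Operators

section PartitionSum

open scoped ENNReal

theorem inv_one_sub_ofReal_exp {x : ℝ} (hx : 0 < x) :
    (1 - ENNReal.ofReal (Real.exp (-x)))⁻¹ = ENNReal.ofReal (Real.exp (eulerLog x)) := by
  have h1 : 0 < 1 - Real.exp (-x) := by
    have := Real.exp_lt_one_iff.2 (neg_lt_zero.2 hx)
    linarith
  rw [← ENNReal.ofReal_one, ← ENNReal.ofReal_sub _ (Real.exp_pos _).le,
    ← ENNReal.ofReal_inv_of_pos h1, eulerLog, Real.exp_neg (Real.log _), Real.exp_log h1]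

theorem ofReal_exp_pow (s : ℝ) (k : ℕ) :
    ENNReal.ofReal (Real.exp (-s)) ^ k = ENNReal.ofReal (Real.exp (-(k * s))) := by
  rw [← ENNReal.ofReal_pow (Real.exp_pos _).le, ← Real.exp_nat_mul, mul_neg]

/-- Partitions with at most `N + 1` parts: remove the smallest part from each of the parts. -/
noncomputable def Ptn.boundedLengthEquiv (N : ℕ) :
    {lam : Ptn // lam.part (N + 1) = 0} ≃ {lam : Ptn // lam.part N = 0} × ℕ where
  toFun lam := (⟨Ptn.ofParts (fun i => lam.1.part i - lam.1.part N)
      (fun i j h => Nat.sub_le_sub_right (lam.1.part_antitone h) _)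
      (⟨N, fun i hi => Nat.sub_eq_zero_of_le (lam.1.part_antitone hi)⟩),
      Nat.sub_self _⟩, lam.1.part N)
  invFun p := ⟨Ptn.ofParts (fun i => if i ≤ N then p.1.1.part i + p.2 else 0)
      (fun i j h => by
        have := p.1.1.part_antitone h
        dsimp only
        split_ifs <;> omega)
      ⟨N + 1, fun i hi => if_neg (by omega)⟩,
    if_neg (by omega)⟩
  left_inv lam := by
    refine Subtype.ext (Ptn.ext fun i => ?_)
    change (if i ≤ N then lam.1.part i - lam.1.part N + lam.1.part N else 0) = lam.1.part i
    split_ifs with h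
    · have := lam.1.part_antitone h
      omega
    · have := lam.1.part_antitone (show N + 1 ≤ i by omega)
      have := lam.2
      omega
  right_inv := by
    rintro ⟨⟨rho, h⟩, k⟩
    refine Prod.ext (Subtype.ext (Ptn.ext fun i => ?_)) ?_
    · change (if i ≤ N then rho.part i + k else 0) - (if N ≤ N then rho.part N + k else 0)
        = rho.part i
      have := fun h => rho.part_antitone (a := N) (b := i) h
      split_ifs <;> omega
    · simp [h]

theorem Ptn.size_boundedLengthEquiv (N : ℕ) (lam : {lam : Ptn // lam.part (N + 1) = 0}) :
    lam.1.size = (Ptn.boundedLengthEquiv N lam).1.1.size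
      + (N + 1) * (Ptn.boundedLengthEquiv N lam).2 := by
  have h1 : ∀ i, N + 1 ≤ i → lam.1.part i = 0 := fun i hi => by
    have := lam.1.part_antitone hi
    have := lam.2
    omega
  have h2 : ∀ i, N + 1 ≤ i → (Ptn.boundedLengthEquiv N lam).1.1.part i = 0 := fun i hi => by
    have := (Ptn.boundedLengthEquiv N lam).1.1.part_antitone (show N ≤ i by omega)
    have := (Ptn.boundedLengthEquiv N lam).1.2
    omega
  have h3 : ∑ _i ∈ Finset.range (N + 1), lam.1.part N = (N + 1) * lam.1.part N := by simp
  rw [Ptn.size_eq_sum_range _ h1, Ptn.size_eq_sum_range _ h2,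
    show (Ptn.boundedLengthEquiv N lam).2 = lam.1.part N from rfl, ← h3,
    ← Finset.sum_add_distrib]
  refine Finset.sum_congr rfl fun i hi => ?_
  have := lam.1.part_antitone (Nat.lt_succ_iff.1 (Finset.mem_range.1 hi))
  change lam.1.part i = lam.1.part i - lam.1.part N + lam.1.part N
  omega

theorem tsum_boundedLength (t : ℝ≥0∞) (N : ℕ) :
    ∑' lam : {lam : Ptn // lam.part N = 0}, t ^ lam.1.size
      = ∏ k ∈ Finset.range N, (1 - t ^ (k + 1))⁻¹ := by
  induction N with
  | zero =>
    have h : ∀ lam : {lam : Ptn // lam.part 0 = 0}, ∀ i, lam.1.part i = 0 := fun lam i => by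
      have := lam.1.part_antitone (Nat.zero_le i)
      have := lam.2
      omega
    have : Unique {lam : Ptn // lam.part 0 = 0} :=
      { default := ⟨Ptn.ofParts (fun _ => 0) (fun _ _ _ => le_rfl) ⟨0, fun _ _ => rfl⟩, rfl⟩
        uniq := fun lam => Subtype.ext (Ptn.ext fun i => by rw [h lam i]; rfl) }
    rw [tsum_eq_single default fun lam h' => absurd (Unique.eq_default lam) h',
      Ptn.size_eq_sum_range (N := 0) _ fun i _ => h _ i]
    simp
  | succ N ih =>
    rw [Finset.prod_range_succ, ← ih, ← ENNReal.tsum_geometric, ← ENNReal.tsum_mul_right]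
    simp_rw [← ENNReal.tsum_mul_left]
    rw [← ENNReal.tsum_prod (f := fun (lam : {lam : Ptn // lam.part N = 0}) (k : ℕ) =>
      t ^ lam.1.size * (t ^ (N + 1)) ^ k), ← (Ptn.boundedLengthEquiv N).tsum_eq]
    refine tsum_congr fun lam => ?_
    rw [Ptn.size_boundedLengthEquiv, pow_add, pow_mul]

theorem sizeSum_one {s : ℝ} (hs : 0 < s) :
    sizeSum (ENNReal.ofReal (Real.exp (-s))) 1 = ENNReal.ofReal (Real.exp (logPartitionGF s)) := by
  set t := ENNReal.ofReal (Real.exp (-s)) with ht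
  have hsum : Summable fun n : ℕ => eulerLog ((n + 1) * s) := summable_eulerLog one_pos hs
  have hpos : ∀ n : ℕ, 0 ≤ eulerLog ((n + 1) * s) := fun n => eulerLog_nonneg (by positivity)
  have hN : ∀ N, ∑' lam : {lam : Ptn // lam.part N = 0}, t ^ lam.1.size
      = ENNReal.ofReal (Real.exp (∑ k ∈ Finset.range N, eulerLog ((k + 1) * s))) := fun N => by
    rw [tsum_boundedLength, Real.exp_sum, ENNReal.ofReal_prod_of_nonneg fun _ _ => (Real.exp_pos _).le]
    refine Finset.prod_congr rfl fun k _ => ?_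
    rw [ht, ofReal_exp_pow, inv_one_sub_ofReal_exp (by positivity)]
    push_cast
    rfl
  apply le_antisymm
  · simp only [sizeSum, Pi.one_apply, mul_one]
    rw [ENNReal.tsum_eq_iSup_sum]
    refine iSup_le fun A => ?_
    choose N hNz using Ptn.exists_part_eq_zero
    have hA : ∀ lam ∈ A, lam.part (A.sup N) = 0 := fun lam hlam => hNz lam _ (Finset.le_sup hlam)
    calc ∑ lam ∈ A, t ^ lam.size
        ≤ ∑' lam : {lam : Ptn // lam.part (A.sup N) = 0}, t ^ lam.1.size := by
          have h := Finset.sum_subtype_of_mem (fun lam : Ptn => t ^ lam.size) hA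
          rw [← h]
          exact ENNReal.sum_le_tsum _
      _ ≤ _ := by
        rw [hN]
        exact ENNReal.ofReal_le_ofReal (Real.exp_le_exp.2
          (hsum.sum_le_tsum _ fun n _ => hpos n))
  · refine le_of_tendsto ((ENNReal.continuous_ofReal.tendsto _).comp
      ((Real.continuous_exp.tendsto _).comp hsum.hasSum.tendsto_sum_nat))
      (Eventually.of_forall fun N => ?_)
    simp only [Function.comp_apply]
    rw [← hN]
    simp only [sizeSum, Pi.one_apply, mul_one]
    exact ENNReal.tsum_comp_le_tsum_of_injective Subtype.val_injective fun lam : Ptn => t ^ lam.size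

/-- Weighted sum over the chains of `k` horizontal strips above `μ`. -/
noncomputable def chainSum (z : ℝ≥0∞) : ℕ → Ptn → ℝ≥0∞
  | 0 => 1
  | k + 1 => stripUp 1 fun lam => z ^ lam.size * chainSum z k lam

theorem chainSum_eq (z : ℝ≥0∞) (k : ℕ) (mu : Ptn) :
    chainSum z k mu
      = (z ^ k) ^ mu.size * stripChain ((List.range k).map fun i => z ^ (i + 1)) 1 mu := by
  induction k generalizing mu with
  | zero => simp [chainSum]
  | succ k ih =>
    rw [List.range_succ, List.map_append, List.map_singleton, stripChain_concat, chainSum]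
    simp only [stripUp]
    rw [← ENNReal.tsum_mul_left]
    refine tsum_congr fun lam => ?_
    have h := pow_mul_stripWeight (z ^ (k + 1)) 1 mu lam
    rw [mul_one] at h
    rw [ih, ← mul_assoc ((z ^ (k + 1)) ^ mu.size), ← h, pow_succ z k, mul_pow]
    ring

theorem chainSum_le (z : ℝ≥0∞) (k : ℕ) (mu : Ptn) : chainSum z k mu ≤ sizeSum z 1 ^ k := by
  induction k generalizing mu with
  | zero => simp [chainSum]
  | succ k ih =>
    simp only [chainSum, stripUp, sizeSum, Pi.one_apply, mul_one]
    rw [pow_succ', ← ENNReal.tsum_mul_right]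
    refine ENNReal.tsum_le_tsum fun lam => ?_
    have : stripWeight 1 mu lam ≤ 1 := by
      unfold stripWeight
      split_ifs <;> simp
    refine (mul_le_of_le_one_left' this).trans ?_
    gcongr
    have := ih lam
    simpa only [sizeSum, Pi.one_apply, mul_one] using this

theorem sizeSum_chainSum (z : ℝ≥0∞) (k : ℕ) :
    sizeSum z (chainSum z k)
      = sizeSum (z ^ (k + 1)) (stripChain ((List.range k).map fun i => z ^ (i + 1)) 1) := by
  refine tsum_congr fun mu => ?_
  rw [chainSum_eq, pow_succ z k, mul_pow]
  ring

theorem sizeSum_chainSum_ne_top {s : ℝ} (hs : 0 < s) (k : ℕ) :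
    sizeSum (ENNReal.ofReal (Real.exp (-s))) (chainSum (ENNReal.ofReal (Real.exp (-s))) k) ≠ ∞ := by
  set z := ENNReal.ofReal (Real.exp (-s)) with hz
  have hfin : sizeSum z 1 ≠ ∞ := by
    rw [hz, sizeSum_one hs]
    exact ENNReal.ofReal_ne_top
  refine ne_top_of_le_ne_top (ENNReal.pow_ne_top hfin (n := k + 1)) ?_
  rw [pow_succ']
  simp only [sizeSum, Pi.one_apply, mul_one]
  rw [← ENNReal.tsum_mul_right]
  refine ENNReal.tsum_le_tsum fun mu => ?_
  gcongr
  have := chainSum_le z k mu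
  simpa only [sizeSum, Pi.one_apply, mul_one] using this

end PartitionSum

section Counting

open scoped ENNReal

theorem hasSum_card_fiber {X : Type*} (size : X → ℕ) {s : ℝ}
    (hfin : ∑' x, ENNReal.ofReal (Real.exp (-s)) ^ size x ≠ ∞) :
    HasSum (fun n : ℕ => (Nat.card {x // size x = n} : ℝ) * Real.exp (-(n * s)))
      (∑' x, ENNReal.ofReal (Real.exp (-s)) ^ size x).toReal := by
  set z := ENNReal.ofReal (Real.exp (-s)) with hz
  have h : ∑' x, z ^ size x = ∑' n, (ENat.card {x // size x = n} : ℝ≥0∞) * z ^ n := by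
    rw [← (Equiv.sigmaFiberEquiv size).tsum_eq, ENNReal.tsum_sigma']
    refine tsum_congr fun n => ?_
    rw [← ENNReal.tsum_const]
    refine tsum_congr fun x => ?_
    rw [Equiv.sigmaFiberEquiv_apply, x.2]
  have hz0 : ∀ n, z ^ n ≠ 0 := fun n => pow_ne_zero _ (by simp [hz, Real.exp_pos])
  have hn : ∀ n, (ENat.card {x // size x = n} : ℝ≥0∞) * z ^ n ≠ ∞ :=
    fun n => ne_top_of_le_ne_top hfin (h ▸ ENNReal.le_tsum n)
  have hterm : ∀ n : ℕ, (Nat.card {x // size x = n} : ℝ) * Real.exp (-(n * s))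
      = ((ENat.card {x // size x = n} : ℝ≥0∞) * z ^ n).toReal := fun n => by
    have hc : (ENat.card {x // size x = n} : ℝ≥0∞) ≠ ∞ := fun hc => hn n (by
      rw [hc, ENNReal.top_mul (hz0 n)])
    have : Finite {x // size x = n} := by
      by_contra hinf
      rw [not_finite_iff_infinite] at hinf
      exact hc (by rw [ENat.card_eq_top_of_infinite]; rfl)
    rw [ENat.card_eq_coe_natCard, ENNReal.toReal_mul, hz, ofReal_exp_pow,
      ENNReal.toReal_ofReal (Real.exp_pos _).le]
    simp
  simp_rw [hterm]
  rw [h, ENNReal.tsum_toReal_eq hn]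
  exact ENNReal.hasSum_toReal (h ▸ hfin)

theorem isDSPP_snoc {k : ℕ} (L : Fin (k + 1) → Ptn) (mu : Ptn) :
    IsDSPP (k + 2) (fun _ => -1) (Fin.snoc L mu : Fin (k + 2) → Ptn)
      ↔ HStrip mu (L (Fin.last k)) ∧ IsDSPP (k + 1) (fun _ => -1) L := by
  have h1 : ∀ i (hi : i < k + 1),
      (Fin.snoc L mu : Fin (k + 2) → Ptn) ⟨i, Nat.lt_succ_of_lt hi⟩ = L ⟨i, hi⟩ := fun i hi =>
    Fin.snoc_castSucc (α := fun _ => Ptn) mu L ⟨i, hi⟩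
  have h2 : ∀ h, (Fin.snoc L mu : Fin (k + 2) → Ptn) ⟨k + 1, h⟩ = mu := fun h =>
    Fin.snoc_last (α := fun _ => Ptn) mu L
  constructor
  · intro h
    refine ⟨?_, fun i hi => ?_⟩
    · have := h k (by omega)
      rw [if_neg (show ¬ (-1 : ℤ) = 1 by decide), h2, h1 k (by omega)] at this
      exact this
    · have := h i (by omega)
      rw [h1 i (by omega), h1 (i + 1) hi] at this
      exact this
  · rintro ⟨h, h'⟩ i hi
    rcases Nat.lt_succ_iff_lt_or_eq.1 hi with hlt | heq
    · have := h' i (by omega)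
      rw [h1 i (by omega), h1 (i + 1) (by omega)]
      exact this
    · obtain rfl : i = k := by omega
      rw [if_neg (show ¬ (-1 : ℤ) = 1 by decide), h2, h1 i (by omega)]
      exact h

open Classical in
theorem tsum_isDSPP_snoc (z : ℝ≥0∞) (k : ℕ) (mu : Ptn) :
    (∑' L : Fin k → Ptn, if IsDSPP (k + 1) (fun _ => -1) (Fin.snoc L mu : Fin (k + 1) → Ptn)
      then z ^ ∑ i, (L i).size else 0) = chainSum z k mu := by
  induction k generalizing mu with
  | zero =>
    rw [tsum_eq_single default fun L h => absurd (Subsingleton.elim _ _) h, if_pos]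
    · simp [chainSum]
    · intro i hi
      omega
  | succ k ih =>
    rw [← (Fin.snocEquiv fun _ => Ptn).tsum_eq, ENNReal.tsum_prod']
    refine tsum_congr fun lam => ?_
    beta_reduce
    rw [stripWeight, ← ih lam]
    rw [← ENNReal.tsum_mul_left, ← ENNReal.tsum_mul_left]
    refine tsum_congr fun L => ?_
    rw [Fin.sum_univ_castSucc]
    simp only [Fin.snocEquiv, Equiv.coe_fn_mk, isDSPP_snoc, Fin.snoc_last, Fin.snoc_castSucc]
    by_cases h : HStrip mu lam <;> simp [h]
    split_ifs <;> simp [pow_add, mul_comm]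

open Classical in
theorem tsum_isDSPP (z : ℝ≥0∞) (k : ℕ) :
    ∑' L : {L : Fin (k + 1) → Ptn // IsDSPP (k + 1) (fun _ => -1) L}, z ^ ∑ i, (L.1 i).size
      = sizeSum z (chainSum z k) := by
  refine (tsum_subtype {L : Fin (k + 1) → Ptn | IsDSPP (k + 1) (fun _ => -1) L}
      (fun L : Fin (k + 1) → Ptn => z ^ ∑ i, (L i).size)).trans ?_
  rw [← (Fin.snocEquiv fun _ => Ptn).tsum_eq, ENNReal.tsum_prod']
  refine tsum_congr fun lam => ?_
  rw [← tsum_isDSPP_snoc, ← ENNReal.tsum_mul_left]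
  refine tsum_congr fun L => ?_
  rw [Set.indicator_apply, Fin.sum_univ_castSucc]
  simp only [Fin.snocEquiv, Equiv.coe_fn_mk, Fin.snoc_last, Fin.snoc_castSucc, Set.mem_ofPred_eq]
  split_ifs <;> simp [pow_add, mul_comm]

theorem hasSum_DSPPcount {s : ℝ} (hs : 0 < s) (k : ℕ) :
    HasSum (fun n : ℕ => (DSPPcount (k + 1) n : ℝ) * Real.exp (-(n * s)))
      (sizeSum (ENNReal.ofReal (Real.exp (-s)))
        (chainSum (ENNReal.ofReal (Real.exp (-s))) k)).toReal := by
  have h := sizeSum_chainSum_ne_top hs k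
  rw [← tsum_isDSPP] at h ⊢
  refine (hasSum_card_fiber _ h).congr_fun fun n => ?_
  rw [DSPPcount, ← Nat.card_congr (Equiv.subtypeSubtypeEquivSubtypeInter _ _)]

end Counting

section ProductFormula

open scoped ENNReal

theorem pairFactor_range' (t : ℝ≥0∞) (f : ℕ → ℝ≥0∞) (k a : ℕ) :
    pairFactor t ((List.range' a k).map f) = ∏ i ∈ Finset.Ico a (a + k),
      ∏ j ∈ Finset.Ico (i + 1) (a + k), (1 - f i * f j)⁻¹ * (1 - t * (t * (f i * f j)))⁻¹ := by
  induction k generalizing a with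
  | zero => simp [pairFactor]
  | succ k ih =>
    rw [List.range'_succ, List.map_cons, pairFactor, ih, show a + (k + 1) = a + 1 + k by ring,
      Finset.prod_eq_prod_Ico_succ_bot (show a < a + 1 + k by omega)]
    congr 1
    rw [List.map_map, ← List.prod_toFinset _ (List.nodup_range' ..)]
    refine Finset.prod_congr ?_ fun _ _ => rfl
    ext j
    simp only [List.mem_toFinset, List.mem_range'_1, Finset.mem_Ico]

theorem pairFactor_range (t : ℝ≥0∞) (f : ℕ → ℝ≥0∞) (k : ℕ) :
    pairFactor t ((List.range k).map fun i => f (i + 1)) = ∏ p ∈ widthPairs (k + 1),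
      ((1 - f p.1 * f p.2)⁻¹ * (1 - t * (t * (f p.1 * f p.2)))⁻¹) := by
  have h : (List.range k).map (fun i => f (i + 1)) = (List.range' 1 k).map f := by
    rw [List.range'_eq_map_range, List.map_map]
    exact List.map_congr_left fun i _ => by simp [add_comm]
  rw [h, pairFactor_range']
  refine (Finset.prod_finset_product (widthPairs (k + 1)) (Finset.Ico 1 (1 + k))
    (fun i => Finset.Ico (i + 1) (1 + k)) (fun p => ?_)
    (f := fun p => (1 - f p.1 * f p.2)⁻¹ * (1 - t * (t * (f p.1 * f p.2)))⁻¹)).symm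
  simp only [mem_widthPairs, Finset.mem_Ico]
  omega

/-- The logarithm of half of the factors picked up in one round. -/
noncomputable def halfRoundLog (m : ℕ) (s : ℝ) (r : ℕ) : ℝ :=
  ∑ i ∈ Finset.range (m - 1), eulerLog (((m * r + i : ℕ) + 1 : ℝ) * s)
    + ∑ p ∈ widthPairs m, eulerLog ((r + ((p.1 + p.2 : ℕ) : ℝ) / (2 * m)) * (2 * m * s))

theorem tendsto_sum_halfRoundLog {m : ℕ} (hm : 1 ≤ m) {s : ℝ} (hs : 0 < s) :
    Tendsto (fun n => ∑ r ∈ Finset.range n, halfRoundLog m s r) atTop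
      (𝓝 (logDSPPGF m s - logPartitionGF (m * s))) := by
  have hm0 : (0 : ℝ) < m := by exact_mod_cast hm
  have h (n : ℕ) : ∑ r ∈ Finset.range n, halfRoundLog m s r
      = ∑ N ∈ Finset.range (m * n), eulerLog ((N + 1) * s)
        + ∑ p ∈ widthPairs m, ∑ r ∈ Finset.range n,
          eulerLog ((r + ((p.1 + p.2 : ℕ) : ℝ) / (2 * m)) * (2 * m * s))
        - ∑ r ∈ Finset.range n, eulerLog ((r + 1) * (m * s)) := by
    induction n with
    | zero => simp
    | succ n ih =>
      obtain ⟨k, rfl⟩ := Nat.exists_eq_add_of_le' hm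
      simp_rw [Finset.sum_range_succ _ n]
      rw [ih, halfRoundLog, mul_add_one, Finset.sum_range_add, Finset.sum_range_succ _ k,
        Finset.sum_add_distrib, Nat.add_sub_cancel,
        show (((k + 1) * n + k : ℕ) + 1 : ℝ) * s = (n + 1) * ((k + 1 : ℕ) * s) by
          push_cast
          ring]
      ring
  simp only [h]
  rw [logDSPPGF]
  refine (Tendsto.add ?_ (tendsto_finsetSum _ fun p hp => ?_)).sub ?_
  · exact (summable_eulerLog one_pos hs).hasSum.tendsto_sum_nat.comp
      (tendsto_id.const_mul_atTop' (by omega))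
  · have hp := mem_widthPairs.1 hp
    have : 0 < p.1 + p.2 := by omega
    exact (summable_eulerLog (b := ((p.1 + p.2 : ℕ) : ℝ) / (2 * m)) (by positivity)
      (by positivity)).hasSum.tendsto_sum_nat
  · exact (summable_eulerLog one_pos (by positivity)).hasSum.tendsto_sum_nat

theorem prod_mul_pairFactor_eq {s : ℝ} (hs : 0 < s) (k q : ℕ) {z t : ℝ≥0∞}
    (hz : z = ENNReal.ofReal (Real.exp (-s))) (ht : t = z ^ (k + 1))
    {l : List ℝ≥0∞} (hl : l = (List.range k).map fun i => z ^ (2 * (k + 1) * q + (i + 1))) :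
    (l.map fun x => (1 - x)⁻¹ * (1 - t * x)⁻¹).prod * pairFactor t l
      = ENNReal.ofReal (Real.exp (halfRoundLog (k + 1) s (2 * q)
        + halfRoundLog (k + 1) s (2 * q + 1))) := by
  have hz' : ∀ n : ℕ, 0 < n →
      (1 - z ^ n)⁻¹ = ENNReal.ofReal (Real.exp (eulerLog (n * s))) := fun n hn => by
    rw [hz, ofReal_exp_pow, inv_one_sub_ofReal_exp (by positivity)]
  have hmul : ∀ n n' : ℕ, 0 < n → 0 < n' → (1 - z ^ n)⁻¹ * (1 - z ^ n')⁻¹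
      = ENNReal.ofReal (Real.exp (eulerLog (n * s) + eulerLog (n' * s))) := fun n n' h h' => by
    rw [hz' n h, hz' n' h', Real.exp_add, ENNReal.ofReal_mul (Real.exp_pos _).le]
  have h1 : (l.map fun x => (1 - x)⁻¹ * (1 - t * x)⁻¹).prod
      = ENNReal.ofReal (Real.exp (∑ i ∈ Finset.range k,
        (eulerLog ((((k + 1) * (2 * q) + i : ℕ) + 1 : ℝ) * s)
          + eulerLog ((((k + 1) * (2 * q + 1) + i : ℕ) + 1 : ℝ) * s)))) := by
    rw [hl, List.map_map, ← List.prod_toFinset _ List.nodup_range, List.toFinset_range,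
      Real.exp_sum, ENNReal.ofReal_prod_of_nonneg fun _ _ => (Real.exp_pos _).le]
    refine Finset.prod_congr rfl fun i _ => ?_
    rw [Function.comp_apply, ht, ← pow_add, hmul _ _ (by omega) (by omega)]
    push_cast
    ring_nf
  have h2 : pairFactor t l = ENNReal.ofReal (Real.exp (∑ p ∈ widthPairs (k + 1),
        (eulerLog (((2 * q : ℕ) + ((p.1 + p.2 : ℕ) : ℝ) / (2 * (k + 1 : ℕ))) * (2 * (k + 1 : ℕ) * s))
          + eulerLog (((2 * q + 1 : ℕ) + ((p.1 + p.2 : ℕ) : ℝ) / (2 * (k + 1 : ℕ)))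
            * (2 * (k + 1 : ℕ) * s))))) := by
    rw [hl, pairFactor_range t (fun i => z ^ (2 * (k + 1) * q + i)), Real.exp_sum,
      ENNReal.ofReal_prod_of_nonneg fun _ _ => (Real.exp_pos _).le]
    refine Finset.prod_congr rfl fun p hp => ?_
    have hp := mem_widthPairs.1 hp
    rw [ht, ← pow_add, ← pow_add, ← pow_add, hmul _ _ (by omega) (by omega)]
    congr 4 <;> push_cast <;> field_simp <;> ring
  rw [h1, h2, ← ENNReal.ofReal_mul (Real.exp_pos _).le, ← Real.exp_add, halfRoundLog, halfRoundLog,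
    Finset.sum_add_distrib, Finset.sum_add_distrib, Nat.add_sub_cancel]
  congr 2
  ring

theorem sizeSum_chainSum_eq {s : ℝ} (hs : 0 < s) (k : ℕ) :
    sizeSum (ENNReal.ofReal (Real.exp (-s))) (chainSum (ENNReal.ofReal (Real.exp (-s))) k)
      = ENNReal.ofReal (Real.exp (logDSPPGF (k + 1) s)) := by
  have hfin := sizeSum_chainSum_ne_top hs k
  set z := ENNReal.ofReal (Real.exp (-s)) with hz
  rw [sizeSum_chainSum] at hfin ⊢
  set t := z ^ (k + 1) with ht
  have hz1 : z < 1 := by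
    rw [hz, ENNReal.ofReal_lt_one]
    exact Real.exp_lt_one_iff.2 (neg_lt_zero.2 hs)
  have hiter : ∀ n, sizeSum t (stripChain ((List.range k).map fun i => z ^ (i + 1)) 1)
      = ENNReal.ofReal (Real.exp (∑ r ∈ Finset.range (2 * n), halfRoundLog (k + 1) s r))
        * sizeSum t (stripChain
          ((List.range k).map fun i => z ^ (2 * (k + 1) * n + (i + 1))) 1) := fun n => by
    induction n with
    | zero => simp
    | succ n ih =>
      rw [ih, sizeSum_stripChain_round, prod_mul_pairFactor_eq hs k n hz ht rfl, ← mul_assoc,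
        ← ENNReal.ofReal_mul (Real.exp_pos _).le, ← Real.exp_add,
        show 2 * (n + 1) = 2 * n + 1 + 1 by ring,
        Finset.sum_range_succ, Finset.sum_range_succ, add_assoc, List.map_map]
      congr 3
      refine List.map_congr_left fun i _ => ?_
      rw [Function.comp_apply, ht, ← pow_add, ← pow_add]
      congr 1
      ring
  have hc0 : Tendsto (fun n => z ^ (2 * (k + 1) * n)) atTop (𝓝 0) := by
    simp_rw [pow_mul z (2 * (k + 1))]
    exact ENNReal.tendsto_pow_atTop_nhds_zero_of_lt_one (pow_lt_one₀ zero_le hz1 (by omega))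
  have hlim := tendsto_sizeSum_stripChain_mul hfin (fun n => pow_le_one₀ zero_le hz1.le) hc0
  have hone : sizeSum t 1 = ENNReal.ofReal (Real.exp (logPartitionGF ((k + 1 : ℕ) * s))) := by
    rw [ht, hz, ofReal_exp_pow, sizeSum_one (by positivity)]
  rw [hone] at hlim
  have hexp := (ENNReal.continuous_ofReal.tendsto _).comp ((Real.continuous_exp.tendsto _).comp
    ((tendsto_sum_halfRoundLog (Nat.le_add_left 1 k) hs).comp
      (tendsto_id.const_mul_atTop' (show 0 < 2 by norm_num))))
  have hmul := ENNReal.Tendsto.mul hexp (Or.inr ENNReal.ofReal_ne_top) hlim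
    (Or.inr ENNReal.ofReal_ne_top)
  rw [← ENNReal.ofReal_mul (Real.exp_pos _).le, ← Real.exp_add, sub_add_cancel] at hmul
  refine tendsto_nhds_unique (tendsto_const_nhds.congr fun n => ?_) hmul
  rw [hiter n]
  simp only [List.map_map, Function.comp_def, id, pow_add]

end ProductFormula

theorem hasSum_exp_eulerLog {x : ℝ} (hx : 0 < x) :
    HasSum (fun r : ℕ => 1 / ((r : ℝ) + 1) * Real.exp (-((r + 1) * x))) (eulerLog x) := by
  have h1 : |Real.exp (-x)| < 1 := by
    rw [abs_of_pos (Real.exp_pos _)]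
    exact Real.exp_lt_one_iff.2 (neg_lt_zero.2 hx)
  refine (Real.hasSum_pow_div_log_of_abs_lt_one h1).congr_fun fun r => ?_
  rw [← Real.exp_nat_mul]
  push_cast
  rw [mul_neg, one_div_mul_eq_div]

theorem hasSum_exp_tsum_eulerLog {β : Type*} {P : β → ℕ} (hP : ∀ b, 0 < P b) {s : ℝ} (hs : 0 < s)
    {T : ℝ} (h : HasSum (fun b => eulerLog (P b * s)) T) :
    HasSum (fun x : β × ℕ => 1 / ((x.2 : ℝ) + 1) * Real.exp (-(((x.2 + 1) * P x.1 : ℕ) * s))) T := by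
  have hb : ∀ b, HasSum (fun r : ℕ => 1 / ((r : ℝ) + 1) * Real.exp (-(((r + 1) * P b : ℕ) * s)))
      (eulerLog (P b * s)) := fun b => by
    have := hP b
    refine (hasSum_exp_eulerLog (show 0 < P b * s by positivity)).congr_fun fun r => ?_
    push_cast
    rw [mul_assoc]
  have hS := (summable_prod_of_nonneg (f := fun x : β × ℕ =>
    1 / ((x.2 : ℝ) + 1) * Real.exp (-(((x.2 + 1) * P x.1 : ℕ) * s)))
    fun x => by positivity).2 ⟨fun b => (hb b).summable, by
      simp only [fun b => (hb b).tsum_eq]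
      exact h.summable⟩
  rw [h.unique (hS.hasSum.prod_fiberwise hb)]
  exact hS.hasSum

/-- The exponents `n` of the factors `1 / (1 - z ^ n)` of the generating function. -/
def factorExponent (m : ℕ) (b : Option (widthPairs m) × ℕ) : ℕ :=
  b.1.elim (b.2 + 1) fun p => 2 * m * b.2 + (p.1.1 + p.1.2)

theorem factorExponent_pos {m : ℕ} (b : Option (widthPairs m) × ℕ) : 0 < factorExponent m b := by
  obtain ⟨_ | p, k⟩ := b
  · exact Nat.succ_pos k
  · have := mem_widthPairs.1 p.2
    simp only [factorExponent, Option.elim]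
    omega

theorem hasSum_eulerLog_factorExponent {m : ℕ} {s : ℝ} (hs : 0 < s) :
    HasSum (fun b => eulerLog (factorExponent m b * s)) (logDSPPGF m s) := by
  have hnone : HasSum (fun k => eulerLog (factorExponent m (none, k) * s)) (logPartitionGF s) := by
    refine (summable_eulerLog one_pos hs).hasSum.congr_fun fun k => ?_
    simp [factorExponent]
  have hsome : ∀ p : widthPairs m, HasSum (fun k => eulerLog (factorExponent m (some p, k) * s))
      (logProgressionGF (((p.1.1 + p.1.2 : ℕ) : ℝ) / (2 * m)) (2 * m * s)) := fun p => by
    have hp := mem_widthPairs.1 p.2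
    have hm0 : 0 < m := by omega
    have : 0 < p.1.1 + p.1.2 := by omega
    refine (summable_eulerLog (b := ((p.1.1 + p.1.2 : ℕ) : ℝ) / (2 * m)) (by positivity)
      (by positivity)).hasSum.congr_fun fun k => ?_
    congr 1
    simp only [factorExponent, Option.elim]
    push_cast
    field_simp
  have hfib : ∀ o, HasSum (fun k => eulerLog (factorExponent m (o, k) * s))
      (o.elim (logPartitionGF s)
        fun p => logProgressionGF (((p.1.1 + p.1.2 : ℕ) : ℝ) / (2 * m)) (2 * m * s)) := by
    rintro (_ | p)
    · exact hnone
    · exact hsome p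
  have hS := (summable_prod_of_nonneg (f := fun b => eulerLog (factorExponent m b * s)) fun b =>
    eulerLog_nonneg (mul_pos (Nat.cast_pos.2 (factorExponent_pos b)) hs)).2
    ⟨fun o => (hfib o).summable, Summable.of_finite⟩
  have h := (hS.hasSum.prod_fiberwise hfib).unique (hasSum_fintype _)
  rw [Fintype.sum_option] at h
  simp only [Option.elim] at h
  rw [Finset.sum_coe_sort (widthPairs m)
    fun p => logProgressionGF (((p.1 + p.2 : ℕ) : ℝ) / (2 * m)) (2 * m * s)] at h
  rw [logDSPPGF, ← h]
  exact hS.hasSum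

theorem exp_mul_sqrt_eq_Cconst {m : ℕ} (hm : 2 ≤ m) :
    √(Real.pi / (Real.pi ^ 2 * ((m : ℝ) ^ 2 + m + 2) / (24 * m)))
      * (Real.pi ^ 2 * ((m : ℝ) ^ 2 + m + 2) / (24 * m) / (2 * Real.pi) * Real.exp
        (-(Real.log (2 * Real.pi) / 2) - ((m : ℝ) - 1) * (m - 2) / 4 * Real.log 2
          - ∑ i ∈ Finset.Icc 1 (m - 2), ∑ j ∈ Finset.Icc (i + 1) (m - i - 1),
            Real.log (Real.sin (((i : ℝ) + j) * Real.pi / (2 * m))))) = Cconst m := by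
  have hm0 : (0 : ℝ) < m := by positivity
  have hpi := Real.pi_pos
  have hsin : ∀ i ∈ Finset.Icc 1 (m - 2), ∀ j ∈ Finset.Icc (i + 1) (m - i - 1),
      0 < Real.sin (((i : ℝ) + j) * Real.pi / (2 * m)) := fun i hi j hj => by
    rw [Finset.mem_Icc] at hi hj
    have h1 : (1 : ℝ) ≤ i := by exact_mod_cast hi.1
    have h2 : (i : ℝ) + j ≤ m := by exact_mod_cast (show i + j ≤ m by omega)
    refine Real.sin_pos_of_pos_of_lt_pi (by positivity) ?_
    rw [div_lt_iff₀ (by positivity)]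
    nlinarith
  have hprod : Real.exp (∑ i ∈ Finset.Icc 1 (m - 2), ∑ j ∈ Finset.Icc (i + 1) (m - i - 1),
      Real.log (Real.sin (((i : ℝ) + j) * Real.pi / (2 * m))))
      = ∏ i ∈ Finset.Icc 1 (m - 2), ∏ j ∈ Finset.Icc (i + 1) (m - i - 1),
        Real.sin (((i : ℝ) + j) * Real.pi / (2 * m)) := by
    rw [Real.exp_sum]
    refine Finset.prod_congr rfl fun i hi => ?_
    rw [Real.exp_sum]
    exact Finset.prod_congr rfl fun j hj => Real.exp_log (hsin i hi j hj)
  have hpow : Real.exp (((m : ℝ) - 1) * (m - 2) / 4 * Real.log 2)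
      = (2 : ℝ) ^ (((m : ℝ) ^ 2 - 3 * m + 14) / 4) / 8 := by
    rw [eq_div_iff (by norm_num), show (8 : ℝ) = 2 ^ (3 : ℝ) by norm_num, mul_comm _ (Real.log 2),
      ← Real.rpow_def_of_pos two_pos, ← Real.rpow_add two_pos]
    congr 1
    ring
  have hsqrt : √(2 * Real.pi) = √2 * √Real.pi := Real.sqrt_mul zero_le_two _
  have hA : Real.pi ^ 2 * ((m : ℝ) ^ 2 + m + 2) / (24 * m)
      = (Real.pi * √((m : ℝ) ^ 2 + m + 2) / (2 * √2 * √(3 * m))) ^ 2 := by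
    rw [div_pow, mul_pow, mul_pow, mul_pow, Real.sq_sqrt (by positivity), Real.sq_sqrt zero_le_two,
      Real.sq_sqrt (by positivity)]
    congr 1
    ring
  rw [Real.exp_sub, Real.exp_sub, hprod, hpow, ← Real.log_sqrt (by positivity), Real.exp_neg,
    Real.exp_log (by positivity), hA, Real.sqrt_div hpi.le, Real.sqrt_sq (by positivity), hsqrt,
    Cconst]
  have : 0 < √Real.pi := Real.sqrt_pos.2 hpi
  have : 0 < √((m : ℝ) ^ 2 + m + 2) := Real.sqrt_pos.2 (by positivity)
  have : 0 < √(3 * (m : ℝ)) := Real.sqrt_pos.2 (by positivity)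
  have : (2 : ℝ) ^ (((m : ℝ) ^ 2 - 3 * m + 14) / 4) ≠ 0 := (Real.rpow_pos_of_pos two_pos _).ne'
  rw [hprod.symm]
  set E := Real.exp (∑ i ∈ Finset.Icc 1 (m - 2), ∑ j ∈ Finset.Icc (i + 1) (m - i - 1),
      Real.log (Real.sin (((i : ℝ) + j) * Real.pi / (2 * m))))
  have hE : E ≠ 0 := (Real.exp_pos _).ne'
  field_simp
  rw [Real.sq_sqrt zero_le_two]
  norm_num

theorem Cconst_pos {m : ℕ} (hm : 2 ≤ m) : 0 < Cconst m := by
  rw [← exp_mul_sqrt_eq_Cconst hm]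
  have hm0 : (0 : ℝ) < m := by positivity
  have hpi := Real.pi_pos
  positivity

theorem tendsto_DSPPcount_mul {m : ℕ} (hm : 2 ≤ m) :
    Tendsto (fun n : ℕ => (DSPPcount m n : ℝ) * n * Real.exp
      (-(2 * √(Real.pi ^ 2 * ((m : ℝ) ^ 2 + m + 2) / (24 * m) * n)))) atTop (𝓝 (Cconst m)) := by
  have hm0 : (0 : ℝ) < m := by positivity
  have hpi := Real.pi_pos
  have hS : ∀ s, 0 < s → HasSum (fun x : (Option (widthPairs m) × ℕ) × ℕ => 1 / ((x.2 : ℝ) + 1)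
      * Real.exp (-(((x.2 + 1) * factorExponent m x.1 : ℕ) * s))) (logDSPPGF m s) := fun s hs =>
    hasSum_exp_tsum_eulerLog factorExponent_pos hs (hasSum_eulerLog_factorExponent hs)
  have hM : ∀ s, 0 < s → expMoment (fun x : (Option (widthPairs m) × ℕ) × ℕ => 1 / ((x.2 : ℝ) + 1))
      (fun x => (x.2 + 1) * factorExponent m x.1) 0 s = logDSPPGF m s := fun s hs => by
    rw [← (hS s hs).tsum_eq, expMoment]
    simp only [pow_zero, mul_one]
  rw [← exp_mul_sqrt_eq_Cconst hm]
  refine tendsto_coeff_of_tendsto_expMoment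
    (w := fun x : (Option (widthPairs m) × ℕ) × ℕ => 1 / ((x.2 : ℝ) + 1))
    (e := fun x => (x.2 + 1) * factorExponent m x.1) (by positivity) (fun _ => by positivity)
    (fun s hs => (hS s hs).summable) ?_ (j := fun n => ((none, n), 0)) ?_ ?_ ?_
    (fun n => Nat.cast_nonneg _) ?_
  · refine (tendsto_logDSPPGF (by omega : 1 ≤ m)).congr' ?_
    filter_upwards [self_mem_nhdsWithin] with s hs
    rw [hM s hs]
  · intro n n' h
    simpa using h
  · intro n
    simp [factorExponent]
  · simp
  · intro s hs
    obtain ⟨k, rfl⟩ := Nat.exists_eq_add_of_le' (show 1 ≤ m by omega)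
    rw [hM s hs]
    have h := hasSum_DSPPcount hs k
    rwa [sizeSum_chainSum_eq hs, ENNReal.toReal_ofReal (Real.exp_pos _).le] at h

/-- **Theorem 1.2**: for every `m ≥ 2`, as `n → ∞`,
`DSPP_m(n) ~ C(m) · (1/n) · exp(π √((m²+m+2)n/(6m)))`. -/
theorem asymptotic_doubled_shifted_plane_partitions (m : ℕ) (hm : 2 ≤ m) :
    Filter.Tendsto
      (fun n : ℕ => (DSPPcount m n : ℝ) /
        (Cconst m * (1 / (n : ℝ)) *
          Real.exp (Real.pi * Real.sqrt ((((m : ℝ) ^ 2 + m + 2) * n) / (6 * m)))))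
      Filter.atTop (nhds 1) := by
  have hC := (Cconst_pos hm).ne'
  have h := (tendsto_DSPPcount_mul hm).div_const (Cconst m)
  rw [div_self hC] at h
  refine h.congr' ?_
  filter_upwards [eventually_gt_atTop 0] with n hn
  have hn' : (n : ℝ) ≠ 0 := by positivity
  have hexp : Real.pi * √((((m : ℝ) ^ 2 + m + 2) * n) / (6 * m))
      = 2 * √(Real.pi ^ 2 * ((m : ℝ) ^ 2 + m + 2) / (24 * m) * n) := by
    rw [← Real.sqrt_sq Real.pi_pos.le, ← Real.sqrt_sq zero_le_two, ← Real.sqrt_mul (by positivity),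
      ← Real.sqrt_mul (by positivity), Real.sqrt_sq Real.pi_pos.le]
    congr 1
    ring
  rw [hexp, Real.exp_neg]
  field_simp
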